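/- arXiv:1802.03630 — 2 statements merged into one kernel-verified Lean document; each statement's English description precedes it below -/
import Mathlib

section
/- Assume τ := sup_{z∈B_Δ} |(log g′)′(z)| < 1/9 and fix y₀ with 1/2 < y₀ < 1. There exist a constant C₀ > 0 and n₀ ≥ 1 such that for all n ≥ n₀ and every point z₀ = x₀ + i·|mₙ(x₀)|·y₀ with x₀ ∈ ℝ, one has d_P(z₀, g^{q_{n+1}}(z₀) − p_{n+1}) ≤ C₀, where d_P is the hyperbolic (Poincaré) distance on the upper half-plane ℍ = {z ∈ ℂ : Im z > 0}. -/
open Filter Topology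

/-- Gauss-map orbit of `α`: `α₀ = α`, `αₙ₊₁ = 1 / fract(αₙ)`. -/
noncomputable def cfGauss (α : ℝ) : ℕ → ℝ
  | 0 => α
  | n + 1 => (Int.fract (cfGauss α n))⁻¹

/-- Partial quotients `aₙ` of the continued fraction of `α`. -/
noncomputable def cfA (α : ℝ) (n : ℕ) : ℤ := ⌊cfGauss α n⌋

/-- Numerators `pₙ` of the convergents of `α`. -/
noncomputable def cfP (α : ℝ) : ℕ → ℤ
  | 0 => cfA α 0
  | 1 => cfA α 1 * cfA α 0 + 1
  | n + 2 => cfA α (n + 2) * cfP α (n + 1) + cfP α n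

/-- Denominators `qₙ` of the convergents of `α` (as natural numbers). -/
noncomputable def cfQ (α : ℝ) : ℕ → ℕ
  | 0 => 1
  | 1 => (cfA α 1).toNat
  | n + 2 => (cfA α (n + 2)).toNat * cfQ α (n + 1) + cfQ α n

/-- `gₙ(x) = g^{qₙ}(x) − pₙ`. -/
noncomputable def cfIter (g : ℝ → ℝ) (α : ℝ) (n : ℕ) (x : ℝ) : ℝ :=
  g^[cfQ α n] x - cfP α n

/-- The point `x + i |mₙ(x)| y₀` of the flow curve at height `y₀` over `x`. -/
noncomputable def liftPt (g : ℝ → ℝ) (α : ℝ) (n : ℕ) (y₀ x : ℝ) : ℂ :=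
  (x : ℂ) + Complex.I * ((|cfIter g α n x - x| : ℝ) : ℂ) * ((y₀ : ℝ) : ℂ)

/-! ### Continued fraction facts -/

noncomputable def cfT (α : ℝ) (n : ℕ) : ℝ := (cfQ α n : ℝ) * α - (cfP α n : ℝ)

lemma cfGauss_irr (α : ℝ) (hα : Irrational α) (n : ℕ) : Irrational (cfGauss α n) := by
  induction n with
  | zero => exact hα
  | succ n ih =>
    simp only [cfGauss, Int.fract]
    exact (ih.sub_intCast _).inv

lemma cfGauss_fract_pos (α : ℝ) (hα : Irrational α) (n : ℕ) : 0 < Int.fract (cfGauss α n) := by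
  rcases (Int.fract_nonneg (cfGauss α n)).lt_or_eq with h | h
  · exact h
  · exfalso
    have h2 := (cfGauss_irr α hα n).sub_intCast ⌊cfGauss α n⌋
    apply h2
    refine ⟨0, ?_⟩
    have : cfGauss α n - ⌊cfGauss α n⌋ = 0 := by
      rw [← h.symm]; rfl
    rw [this]; simp

lemma cfGauss_gt_one (α : ℝ) (hα : Irrational α) (n : ℕ) : 1 < cfGauss α (n + 1) := by
  simp only [cfGauss]
  exact (one_lt_inv₀ (cfGauss_fract_pos α hα n)).2 (Int.fract_lt_one _)

lemma cfA_pos (α : ℝ) (hα : Irrational α) (n : ℕ) : 1 ≤ cfA α (n + 1) := by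
  unfold cfA
  rw [Int.le_floor]
  exact_mod_cast (cfGauss_gt_one α hα n).le

lemma cfA_toNat (α : ℝ) (hα : Irrational α) (n : ℕ) :
    ((cfA α (n + 1)).toNat : ℤ) = cfA α (n + 1) :=
  Int.toNat_of_nonneg (by linarith [cfA_pos α hα n])

lemma cfQ_pos (α : ℝ) (hα : Irrational α) (n : ℕ) : 1 ≤ cfQ α n ∧ 1 ≤ cfQ α (n + 1) := by
  induction n with
  | zero =>
    refine ⟨le_refl _, ?_⟩
    have h1 := cfA_toNat α hα 0
    have h2 := cfA_pos α hα 0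
    simp only [cfQ]
    simp only [zero_add] at h1 h2
    omega
  | succ n ih =>
    refine ⟨ih.2, ?_⟩
    simp only [cfQ]
    have := ih.1
    exact le_trans this (Nat.le_add_left _ _)

lemma cfQ_mono (α : ℝ) (hα : Irrational α) (n : ℕ) : cfQ α n ≤ cfQ α (n + 1) := by
  cases n with
  | zero => exact (cfQ_pos α hα 0).2
  | succ n =>
    have h1 := cfA_toNat α hα (n+1)
    have h2 := cfA_pos α hα (n+1)
    have h3 : 1 ≤ (cfA α (n+1+1)).toNat := by omega
    show cfQ α (n+1) ≤ (cfA α (n + 2)).toNat * cfQ α (n + 1) + cfQ α n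
    nlinarith [Nat.mul_le_mul_right (cfQ α (n+1)) h3, Nat.zero_le (cfQ α n)]

lemma cfT_rec (α : ℝ) (hα : Irrational α) (n : ℕ) :
    cfT α (n + 2) = (cfA α (n + 2) : ℝ) * cfT α (n + 1) + cfT α n := by
  have h1 : (((cfA α (n + 2)).toNat : ℕ) : ℝ) = (cfA α (n + 2) : ℝ) := by
    exact_mod_cast cfA_toNat α hα (n + 1)
  simp only [cfT, cfQ, cfP]
  push_cast
  rw [h1]; ring

lemma cfT_step (α : ℝ) (hα : Irrational α) (n : ℕ) :
    cfT α (n + 1) = - Int.fract (cfGauss α (n + 1)) * cfT α n := by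
  induction n with
  | zero =>
    have h1 : (((cfA α 1).toNat : ℕ) : ℝ) = (cfA α 1 : ℝ) := by
      exact_mod_cast cfA_toNat α hα 0
    have h2 := cfGauss_fract_pos α hα 0
    have h3 : cfGauss α 1 * Int.fract (cfGauss α 0) = 1 := by
      simp only [cfGauss] at h2 ⊢
      exact inv_mul_cancel₀ h2.ne'
    simp only [cfT, cfQ, cfP, zero_add]
    rw [h1]
    have h4 : Int.fract (cfGauss α 0) = α - cfA α 0 := rfl
    have h5 : Int.fract (cfGauss α 1) = cfGauss α 1 - cfA α 1 := rfl
    rw [h5]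
    rw [h4] at h3
    push_cast
    linear_combination h3
  | succ n ih =>
    have h2 := cfGauss_fract_pos α hα (n+1)
    have h3 : cfGauss α (n+2) * Int.fract (cfGauss α (n+1)) = 1 := by
      simp only [cfGauss] at h2 ⊢
      exact inv_mul_cancel₀ h2.ne'
    have h5 : Int.fract (cfGauss α (n+2)) = cfGauss α (n+2) - cfA α (n+2) := rfl
    rw [show n + 1 + 1 = n + 2 from rfl, cfT_rec α hα n, h5]
    linear_combination (cfGauss α (n+2)) * ih - cfT α n * h3

lemma cfT_ne (α : ℝ) (hα : Irrational α) (n : ℕ) : cfT α n ≠ 0 := by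
  induction n with
  | zero =>
    have h2 := cfGauss_fract_pos α hα 0
    have h4 : Int.fract (cfGauss α 0) = α - cfA α 0 := rfl
    simp only [cfT, cfQ, cfP]
    rw [h4] at h2
    push_cast
    rw [one_mul]; exact h2.ne'
  | succ n ih =>
    rw [cfT_step α hα n]
    exact mul_ne_zero (neg_ne_zero.2 (cfGauss_fract_pos α hα _).ne') ih

lemma cfDet (α : ℝ) (hα : Irrational α) (n : ℕ) :
    (cfP α (n + 1) * cfQ α n - cfP α n * cfQ α (n + 1) : ℤ) = (-1) ^ n := by
  induction n with
  | zero =>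
    have h1 := cfA_toNat α hα 0
    simp only [cfQ, cfP, zero_add] at *
    rw [h1]; push_cast; ring
  | succ n ih =>
    have h1 := cfA_toNat α hα (n+1)
    have e1 : cfP α (n+1+1) = cfA α (n + 2) * cfP α (n + 1) + cfP α n := rfl
    have e2 : cfQ α (n+1+1) = (cfA α (n + 2)).toNat * cfQ α (n + 1) + cfQ α n := rfl
    rw [e1, e2, pow_succ, ← ih]
    push_cast
    rw [show n + 2 = n + 1 + 1 from rfl, h1]; ring

/-- best approximation -/
lemma cf_best (α : ℝ) (hα : Irrational α) (n : ℕ) (d k : ℤ) (hd : |d| < cfQ α (n + 1))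
    (hdk : d ≠ 0 ∨ k ≠ 0) : |cfT α n| ≤ |(d : ℝ) * α - k| := by
  obtain ⟨s, hs, hdet⟩ : ∃ s : ℤ, s * s = 1 ∧
      cfP α (n + 1) * cfQ α n - cfP α n * cfQ α (n + 1) = s := by
    refine ⟨(-1) ^ n, ?_, cfDet α hα n⟩
    rw [← pow_add, ← two_mul, pow_mul]; norm_num
  set Q := (cfQ α n : ℤ) with hQ
  set Q' := (cfQ α (n+1) : ℤ) with hQ'
  set P := cfP α n with hP
  set P' := cfP α (n+1) with hP'
  have hQ1 : 1 ≤ Q := by have := (cfQ_pos α hα n).1; omega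
  have hQ1' : 1 ≤ Q' := by have := (cfQ_pos α hα n).2; omega
  obtain ⟨u, v, hdu, hku⟩ : ∃ u v : ℤ, d = u * Q + v * Q' ∧ k = u * P + v * P' := by
    refine ⟨s * (P' * d - Q' * k), s * (Q * k - P * d), ?_, ?_⟩
    · linear_combination (-d) * hs - s * d * hdet
    · linear_combination (-k) * hs - s * k * hdet
  have hval : (d : ℝ) * α - k = u * cfT α n + v * cfT α (n + 1) := by
    have e1 : (d : ℝ) = u * (cfQ α n : ℝ) + v * (cfQ α (n+1) : ℝ) := by
      rw [hdu]; push_cast; rw [hQ, hQ']; push_cast; ring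
    have e2 : (k : ℝ) = u * (cfP α n : ℝ) + v * (cfP α (n+1) : ℝ) := by
      rw [hku]; push_cast; rfl
    rw [e1, e2]; unfold cfT; ring
  rw [hval, cfT_step α hα n]
  have hf := cfGauss_fract_pos α hα (n+1)
  set f := Int.fract (cfGauss α (n+1))
  have hrw : (u : ℝ) * cfT α n + v * (-f * cfT α n) = (u - v * f) * cfT α n := by ring
  rw [hrw, abs_mul]
  apply le_mul_of_one_le_left (abs_nonneg _)
  have habs := abs_lt.1 hd
  have hu : u ≠ 0 := by
    rintro rfl
    have hv : v = 0 := by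
      rcases lt_trichotomy v 0 with h | h | h
      · nlinarith
      · exact h
      · nlinarith
    subst hv
    simp at hdu hku
    rcases hdk with h | h <;> contradiction
  rcases lt_or_gt_of_ne hu with h | h
  · have hv : 0 ≤ v := by
      by_contra hv
      push Not at hv
      nlinarith
    have h1 : (u : ℝ) ≤ -1 := by exact_mod_cast (by omega : u ≤ -1)
    have h2 : (0 : ℝ) ≤ v := by exact_mod_cast hv
    rw [le_abs]; right; nlinarith [mul_nonneg h2 hf.le]
  · have hv : v ≤ 0 := by
      by_contra hv
      push Not at hv
      nlinarith
    have h1 : (1 : ℝ) ≤ u := by exact_mod_cast (by omega : 1 ≤ u)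
    have h2 : (v : ℝ) ≤ 0 := by exact_mod_cast hv
    rw [le_abs]; left; nlinarith [mul_nonneg (neg_nonneg.2 h2) hf.le]

/-! ### Disjoint intervals modulo one -/

lemma sum_len_le_one (N : ℕ) (lo hi : ℕ → ℝ) (hlh : ∀ i < N, lo i ≤ hi i)
    (hdis : ∀ i < N, ∀ j < N, ∀ k : ℤ, (i ≠ j ∨ k ≠ 0) →
      hi j + k ≤ lo i ∨ hi i ≤ lo j + k) :
    ∑ i ∈ Finset.range N, (hi i - lo i) ≤ 1 := by
  classical
  set t : Set ℝ := ⋃ i ∈ Finset.range N, Set.Ioo (lo i) (hi i) with ht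
  have hmeas : MeasurableSet t :=
    Finset.measurableSet_biUnion _ (fun i _ => measurableSet_Ioo)
  have hvol : MeasureTheory.volume t ≤ MeasureTheory.volume (Set.Ioc (0:ℝ) (0 + 1)) := by
    refine (isAddFundamentalDomain_Ioc (T := (1:ℝ)) one_pos 0
      MeasureTheory.volume).measure_le_of_pairwise_disjoint hmeas.nullMeasurableSet ?_
    intro a b hab
    apply Disjoint.aedisjoint
    apply Set.disjoint_of_subset Set.inter_subset_left Set.inter_subset_left
    rw [Set.disjoint_left]
    intro x hxa hxb
    obtain ⟨a, ka, rfl⟩ := a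
    obtain ⟨b, kb, rfl⟩ := b
    rw [Set.mem_vadd_set] at hxa hxb
    obtain ⟨y, hy, hyx⟩ := hxa
    obtain ⟨z, hz, hzx⟩ := hxb
    simp only [ht, Set.mem_iUnion, Finset.mem_range, Set.mem_Ioo] at hy hz
    obtain ⟨i, hi1, hi2⟩ := hy
    obtain ⟨j, hj1, hj2⟩ := hz
    have h1 : (ka : ℝ) + y = x := by
      rw [← hyx]; simp [AddSubgroup.vadd_def]
    have h2 : (kb : ℝ) + z = x := by
      rw [← hzx]; simp [AddSubgroup.vadd_def]
    have hne : kb - ka ≠ 0 := by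
      intro h
      apply hab
      have : ka = kb := by omega
      subst this; rfl
    have := hdis i hi1 j hj1 (kb - ka) (Or.inr hne)
    push_cast at this
    rcases this with h | h <;> linarith [hi2.1, hi2.2, hj2.1, hj2.2]
  have hsum : MeasureTheory.volume t = ∑ i ∈ Finset.range N, ENNReal.ofReal (hi i - lo i) := by
    rw [ht, MeasureTheory.measure_biUnion_finset]
    · simp [Real.volume_Ioo]
    · intro i hi1 j hj1 hij
      show Disjoint (Set.Ioo (lo i) (hi i)) (Set.Ioo (lo j) (hi j))
      rw [Set.disjoint_left]
      intro x hx hx'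
      have := hdis i (by simpa using hi1) j (by simpa using hj1) 0 (Or.inl hij)
      simp only [Set.mem_Ioo] at hx hx'
      push_cast at this
      rcases this with h | h <;> linarith [hx.1, hx.2, hx'.1, hx'.2]
    · intro i _; exact measurableSet_Ioo
  rw [hsum, ← ENNReal.ofReal_sum_of_nonneg] at hvol
  · rw [Real.volume_Ioc] at hvol
    have := (ENNReal.ofReal_le_ofReal_iff (by norm_num)).1 hvol
    linarith
  · intro i hi1
    linarith [hlh i (by simpa using hi1)]

/-! ### Real dynamics -/

structure CircDyn (g : ℝ → ℝ) (α : ℝ) (φ : ℝ → ℝ) (τ : ℝ) : Prop where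
  irr : Irrational α
  mono : StrictMono g
  surj : Function.Surjective g
  per : ∀ x, g (x + 1) = g x + 1
  ord : ∀ (x : ℝ) (i j : ℕ) (k : ℤ), (i : ℝ) * α < j * α + k → g^[i] x < g^[j] x + k
  der : ∀ x, HasDerivAt g (Real.exp (φ x)) x
  phiper : ∀ x, φ (x + 1) = φ x
  lip : ∀ x y, |φ x - φ y| ≤ τ * |x - y|
  tnn : 0 ≤ τ

noncomputable def mm (g : ℝ → ℝ) (α : ℝ) (n : ℕ) (x : ℝ) : ℝ := cfIter g α n x - x

noncomputable def Lam (g φ : ℝ → ℝ) (k : ℕ) (x : ℝ) : ℝ := ∑ i ∈ Finset.range k, φ (g^[i] x)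

lemma per_int (g : ℝ → ℝ) (c : ℝ) (per : ∀ x, g (x + 1) = g x + c) (x : ℝ) (k : ℤ) :
    g (x + k) = g x + k * c := by
  induction k using Int.induction_on with
  | zero => simp
  | succ i ih => push_cast at *; rw [← add_assoc, per, ih]; ring
  | pred i ih =>
    push_cast at *
    have := per (x + (-(i:ℝ) - 1))
    rw [show x + (-(i:ℝ) - 1) + 1 = x + -(i:ℝ) by ring, ih] at this
    linarith

namespace CircDyn

variable {g : ℝ → ℝ} {α : ℝ} {φ : ℝ → ℝ} {τ : ℝ}

lemma ord_le (D : CircDyn g α φ τ) (x : ℝ) (i j : ℕ) (k : ℤ) (h : (i : ℝ) * α ≤ j * α + k) :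
    g^[i] x ≤ g^[j] x + k := by
  rcases h.lt_or_eq with h | h
  · exact (D.ord x i j k h).le
  · by_cases hij : i = j
    · subst hij
      have : (k : ℝ) = 0 := by linarith
      rw [this]; simp
    · exfalso
      have h1 : (((i : ℤ) - j : ℤ) : ℝ) * α = k := by push_cast; linarith
      have h2 : ((i : ℤ) - j : ℤ) ≠ 0 := by omega
      exact (D.irr.intCast_mul h2).ne_int k h1

lemma iter_int (D : CircDyn g α φ τ) (i : ℕ) (x : ℝ) (k : ℤ) : g^[i] (x + k) = g^[i] x + k := by
  induction i generalizing x with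
  | zero => rfl
  | succ i ih =>
    rw [Function.iterate_succ_apply, Function.iterate_succ_apply,
      per_int g 1 D.per, mul_one, ih]

lemma iter_sub_int (D : CircDyn g α φ τ) (i : ℕ) (x : ℝ) (k : ℤ) :
    g^[i] (x - k) = g^[i] x - k := by
  have := D.iter_int i x (-k)
  push_cast at this
  rw [sub_eq_add_neg, this, sub_eq_add_neg]

lemma phi_int (D : CircDyn g α φ τ) (x : ℝ) (k : ℤ) : φ (x + k) = φ x := by
  have := per_int φ 0 (by simpa using D.phiper) x k
  simpa using this

lemma phi_sub_int (D : CircDyn g α φ τ) (x : ℝ) (k : ℤ) : φ (x - k) = φ x := by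
  have := D.phi_int x (-k)
  push_cast at this
  rw [sub_eq_add_neg, this]

lemma lam_int (D : CircDyn g α φ τ) (i : ℕ) (x : ℝ) (k : ℤ) : Lam g φ i (x + k) = Lam g φ i x := by
  unfold Lam
  apply Finset.sum_congr rfl
  intro j _
  rw [D.iter_int, D.phi_int]

lemma cfIter_iter (D : CircDyn g α φ τ) (n i : ℕ) (x : ℝ) :
    cfIter g α n (g^[i] x) = g^[i] (cfIter g α n x) := by
  unfold cfIter
  rw [D.iter_sub_int, ← Function.iterate_add_apply, ← Function.iterate_add_apply, add_comm]

lemma cfIter_int (D : CircDyn g α φ τ) (n : ℕ) (x : ℝ) (k : ℤ) :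
    cfIter g α n (x + k) = cfIter g α n x + k := by
  unfold cfIter
  rw [D.iter_int]; ring

lemma cfIter_comm (D : CircDyn g α φ τ) (n m : ℕ) (x : ℝ) :
    cfIter g α n (cfIter g α m x) = cfIter g α m (cfIter g α n x) := by
  unfold cfIter
  rw [D.iter_sub_int, D.iter_sub_int, ← Function.iterate_add_apply, ← Function.iterate_add_apply,
    add_comm]
  ring

lemma mono_iter (D : CircDyn g α φ τ) (i : ℕ) : StrictMono (g^[i]) := D.mono.iterate i

lemma cfIter_pos (D : CircDyn g α φ τ) (n : ℕ) (x : ℝ) (h : 0 < cfT α n) : x < cfIter g α n x := by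
  have := D.ord x 0 (cfQ α n) (-cfP α n) (by unfold cfT at h; push_cast; linarith)
  push_cast at this
  unfold cfIter
  simpa [sub_eq_add_neg] using this

lemma cfIter_neg (D : CircDyn g α φ τ) (n : ℕ) (x : ℝ) (h : cfT α n < 0) : cfIter g α n x < x := by
  have := D.ord x (cfQ α n) 0 (cfP α n) (by unfold cfT at h; push_cast; linarith)
  unfold cfIter
  simp at this
  linarith

lemma mm_ne (D : CircDyn g α φ τ) (n : ℕ) (x : ℝ) : mm g α n x ≠ 0 := by
  unfold mm
  rcases lt_or_gt_of_ne (cfT_ne α D.irr n) with h | h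
  · linarith [D.cfIter_neg n x h]
  · linarith [D.cfIter_pos n x h]

lemma sum_mm (D : CircDyn g α φ τ) (n : ℕ) (x : ℝ) :
    ∑ i ∈ Finset.range (cfQ α (n + 1)), |mm g α n (g^[i] x)| ≤ 1 := by
  have key := sum_len_le_one (cfQ α (n+1))
    (fun i => min (g^[i] x) (cfIter g α n (g^[i] x)))
    (fun i => max (g^[i] x) (cfIter g α n (g^[i] x)))
    (fun i _ => min_le_max) ?_
  · refine le_trans (le_of_eq ?_) key
    apply Finset.sum_congr rfl
    intro i _
    rw [max_sub_min_eq_abs]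
    rfl
  intro i hi j hj k hk
  have hb := cf_best α D.irr n ((i:ℤ) - j) k (by rw [abs_lt]; omega)
    (by rcases hk with h | h
        · left; omega
        · right; exact h)
  push_cast at hb
  have e : ∀ i, cfIter g α n (g^[i] x) = g^[cfQ α n + i] x - cfP α n := by
    intro i; unfold cfIter; rw [Function.iterate_add_apply]
  rcases lt_or_gt_of_ne (cfT_ne α D.irr n) with h | h
  · have hc : ∀ i, cfIter g α n (g^[i] x) ≤ g^[i] x := fun i => (D.cfIter_neg n _ h).le
    simp only [min_eq_right (hc _), max_eq_left (hc _)]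
    rw [abs_of_neg h, le_abs] at hb
    unfold cfT at hb
    rw [e, e]
    rcases hb with hb | hb
    · left
      have := D.ord_le x j (cfQ α n + i) (-cfP α n - k) (by push_cast; linarith)
      push_cast at this; linarith
    · right
      have := D.ord_le x i (cfQ α n + j) (-cfP α n + k) (by push_cast; linarith)
      push_cast at this; linarith
  · have hc : ∀ i, g^[i] x ≤ cfIter g α n (g^[i] x) := fun i => (D.cfIter_pos n _ h).le
    simp only [min_eq_left (hc _), max_eq_right (hc _)]
    rw [abs_of_pos h, le_abs] at hb
    unfold cfT at hb
    rw [e, e]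
    rcases hb with hb | hb
    · left
      have := D.ord_le x (cfQ α n + j) i (cfP α n - k) (by push_cast; linarith)
      push_cast at this; linarith
    · right
      have := D.ord_le x (cfQ α n + i) j (cfP α n + k) (by push_cast; linarith)
      push_cast at this; linarith

lemma sum_mm' (D : CircDyn g α φ τ) (n k : ℕ) (hk : k ≤ cfQ α (n + 1)) (x : ℝ) :
    ∑ i ∈ Finset.range k, |mm g α n (g^[i] x)| ≤ 1 := by
  refine le_trans ?_ (D.sum_mm n x)
  apply Finset.sum_le_sum_of_subset_of_nonneg
  · exact Finset.range_subset_range.2 hk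
  · intros; exact abs_nonneg _

lemma mm_le_one (D : CircDyn g α φ τ) (n : ℕ) (x : ℝ) : |mm g α n x| ≤ 1 := by
  have := D.sum_mm' n 1 (cfQ_pos α D.irr n).2 x
  simpa using this

/-- distortion -/
lemma distort (D : CircDyn g α φ τ) (n k : ℕ) (hk : k ≤ cfQ α (n + 1)) (c x y : ℝ)
    (hx : x ∈ Set.uIcc c (cfIter g α n c)) (hy : y ∈ Set.uIcc c (cfIter g α n c)) :
    |Lam g φ k x - Lam g φ k y| ≤ τ := by
  unfold Lam
  rw [← Finset.sum_sub_distrib]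
  calc |∑ i ∈ Finset.range k, (φ (g^[i] x) - φ (g^[i] y))|
      ≤ ∑ i ∈ Finset.range k, |φ (g^[i] x) - φ (g^[i] y)| := Finset.abs_sum_le_sum_abs _ _
    _ ≤ ∑ i ∈ Finset.range k, τ * |mm g α n (g^[i] c)| := by
        apply Finset.sum_le_sum
        intro i _
        refine (D.lip _ _).trans (mul_le_mul_of_nonneg_left ?_ D.tnn)
        have h1 := (D.mono_iter i).monotone.mapsTo_uIcc hx
        have h2 := (D.mono_iter i).monotone.mapsTo_uIcc hy
        unfold mm
        rw [D.cfIter_iter]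
        exact Set.abs_sub_le_of_uIcc_subset_uIcc (Set.uIcc_subset_uIcc h2 h1)
    _ = τ * ∑ i ∈ Finset.range k, |mm g α n (g^[i] c)| := by rw [Finset.mul_sum]
    _ ≤ τ * 1 := mul_le_mul_of_nonneg_left (D.sum_mm' n k hk c) D.tnn
    _ = τ := mul_one _

lemma lam_shift (D : CircDyn g α φ τ) (n j : ℕ) (hj : j ≤ cfQ α (n + 1)) (x : ℝ) :
    |Lam g φ (cfQ α n) (g^[j] x) - Lam g φ (cfQ α n) x| ≤ τ := by
  have e : Lam g φ (cfQ α n) (g^[j] x) - Lam g φ (cfQ α n) x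
      = Lam g φ j (cfIter g α n x) - Lam g φ j x := by
    have h1 : ∀ a b : ℕ, Lam g φ (a + b) x = Lam g φ a x + Lam g φ b (g^[a] x) := by
      intro a b
      unfold Lam
      rw [Finset.sum_range_add]
      congr 1
      apply Finset.sum_congr rfl
      intro i _
      rw [← Function.iterate_add_apply, add_comm i a]
    have h2 := h1 (cfQ α n) j
    have h3 := h1 j (cfQ α n)
    rw [add_comm] at h3
    have h4 : Lam g φ j (cfIter g α n x) = Lam g φ j (g^[cfQ α n] x) := by
      have := D.lam_int j (cfIter g α n x) (cfP α n)
      rw [← this]; congr 1; unfold cfIter; ring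
    rw [h4]; linarith
  rw [e]
  exact D.distort n j hj x _ _ Set.right_mem_uIcc Set.left_mem_uIcc

lemma der_iter (D : CircDyn g α φ τ) (k : ℕ) (x : ℝ) :
    HasDerivAt (g^[k]) (Real.exp (Lam g φ k x)) x := by
  induction k with
  | zero => simpa [Lam] using hasDerivAt_id x
  | succ k ih =>
    rw [Function.iterate_succ']
    have := (D.der (g^[k] x)).comp x ih
    have e : Real.exp (Lam g φ (k + 1) x)
        = Real.exp (φ (g^[k] x)) * Real.exp (Lam g φ k x) := by
      unfold Lam
      rw [Finset.sum_range_succ, Real.exp_add, mul_comm]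
    rw [e]
    exact this

lemma der_cfIter (D : CircDyn g α φ τ) (n : ℕ) (x : ℝ) :
    HasDerivAt (cfIter g α n) (Real.exp (Lam g φ (cfQ α n) x)) x :=
  (D.der_iter (cfQ α n) x).sub_const _

lemma exists_lam_zero (D : CircDyn g α φ τ) (n : ℕ) : ∃ ξ, Lam g φ (cfQ α n) ξ = 0 := by
  obtain ⟨c, _, hc⟩ := exists_hasDerivAt_eq_slope (g^[cfQ α n])
    (fun x => Real.exp (Lam g φ (cfQ α n) x)) (a := 0) (b := 1) one_pos
    (fun x _ => (D.der_iter (cfQ α n) x).continuousAt.continuousWithinAt)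
    (fun x _ => D.der_iter (cfQ α n) x)
  refine ⟨c, ?_⟩
  have := D.iter_int (cfQ α n) 0 1
  push_cast at this
  rw [zero_add] at this
  rw [this] at hc
  simpa using hc

end CircDyn

lemma cfT_signs (α : ℝ) (hα : Irrational α) (n : ℕ) :
    (0 < cfT α n ∧ cfT α (n+1) < 0 ∧ 0 < cfT α n + cfT α (n+1)) ∨
    (cfT α n < 0 ∧ 0 < cfT α (n+1) ∧ cfT α n + cfT α (n+1) < 0) := by
  have h1 := cfT_step α hα n
  have h2 := cfGauss_fract_pos α hα (n+1)
  have h3 := Int.fract_lt_one (cfGauss α (n+1))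
  rcases lt_or_gt_of_ne (cfT_ne α hα n) with h | h
  · right; refine ⟨h, ?_, ?_⟩ <;> rw [h1] <;> nlinarith
  · left; refine ⟨h, ?_, ?_⟩ <;> rw [h1] <;> nlinarith

namespace CircDyn

variable {g : ℝ → ℝ} {α : ℝ} {φ : ℝ → ℝ} {τ : ℝ}

lemma surj_cfIter (D : CircDyn g α φ τ) (n : ℕ) (y : ℝ) : ∃ c, cfIter g α n c = y := by
  obtain ⟨c, hc⟩ := D.surj.iterate (cfQ α n) (y + cfP α n)
  exact ⟨c, by unfold cfIter; rw [hc]; ring⟩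

lemma cover (D : CircDyn g α φ τ) (n : ℕ) (x ξ : ℝ) :
    ∃ j < cfQ α n + cfQ α (n + 1), ∃ k : ℤ, ∃ c,
      x ∈ Set.uIcc c (cfIter g α n c) ∧ g^[j] ξ + k ∈ Set.uIcc c (cfIter g α n c) := by
  set N := cfQ α n + cfQ α (n + 1) with hN
  have hq := (cfQ_pos α D.irr n)
  obtain ⟨j, hj, hmax⟩ := Finset.exists_max_image (Finset.range N)
    (fun j => g^[j] ξ + (⌊x - g^[j] ξ⌋ : ℤ)) ⟨0, by simp; omega⟩
  rw [Finset.mem_range] at hj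
  set k : ℤ := ⌊x - g^[j] ξ⌋ with hk
  have hP : g^[j] ξ + k ≤ x := by
    have := Int.floor_le (x - g^[j] ξ); linarith
  have hgt : ∀ j' < N, ∀ k' : ℤ, g^[j] ξ + k < g^[j'] ξ + k' → x < g^[j'] ξ + k' := by
    intro j' hj' k' h
    by_contra hcon
    push Not at hcon
    have h1 : k' ≤ ⌊x - g^[j'] ξ⌋ := Int.le_floor.2 (by linarith)
    have h2 := hmax j' (by simpa using hj')
    have h3 : (k' : ℝ) ≤ (⌊x - g^[j'] ξ⌋ : ℤ) := by exact_mod_cast h1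
    linarith
  refine ⟨j, hj, k, ?_⟩
  rcases cfT_signs α D.irr n with ⟨h0, h1, h2⟩ | ⟨h0, h1, h2⟩
  · refine ⟨g^[j] ξ + k, ?_, Set.left_mem_uIcc⟩
    rw [Set.mem_uIcc]
    left
    refine ⟨hP, ?_⟩
    rw [D.cfIter_int]
    unfold cfIter
    rw [← Function.iterate_add_apply]
    unfold cfT at h0 h1 h2
    by_cases hjc : j < cfQ α (n+1)
    · have a1 := D.ord ξ j (cfQ α n + j) (-cfP α n) (by push_cast; linarith)
      have a2 := hgt (cfQ α n + j) (by omega) (-cfP α n + k) (by push_cast at a1 ⊢; linarith)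
      push_cast at a2; linarith
    · push Not at hjc
      obtain ⟨i, rfl⟩ := Nat.exists_eq_add_of_le hjc
      have a1 := D.ord ξ (cfQ α (n+1) + i) i (cfP α (n+1)) (by push_cast; linarith)
      have a2 := hgt i (by omega) (cfP α (n+1) + k) (by push_cast at a1 ⊢; linarith)
      have a3 := D.ord ξ i (cfQ α n + (cfQ α (n+1) + i)) (-cfP α n - cfP α (n+1))
        (by push_cast; linarith)
      push_cast at a2 a3; linarith
  · obtain ⟨c, hc⟩ := D.surj_cfIter n (g^[j] ξ + k)
    refine ⟨c, ?_, by rw [hc]; exact Set.right_mem_uIcc⟩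
    rw [Set.mem_uIcc]
    right
    refine ⟨by rw [hc]; exact hP, ?_⟩
    have hc2 : g^[cfQ α n] c = g^[j] ξ + k + cfP α n := by
      rw [← hc]; unfold cfIter; ring
    unfold cfT at h0 h1 h2
    by_cases hjc : j < cfQ α n
    · have a1 := D.ord ξ j (cfQ α (n+1) + j) (-cfP α (n+1)) (by push_cast; linarith)
      have a2 := hgt (cfQ α (n+1) + j) (by omega) (-cfP α (n+1) + k)
        (by push_cast at a1 ⊢; linarith)
      refine a2.le.trans ?_
      rw [← (D.mono_iter (cfQ α n)).le_iff_le, hc2, D.iter_int, ← Function.iterate_add_apply]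
      have a3 := D.ord ξ (cfQ α n + (cfQ α (n+1) + j)) j (cfP α n + cfP α (n+1))
        (by push_cast; linarith)
      push_cast at a3 ⊢; linarith
    · push Not at hjc
      obtain ⟨i, rfl⟩ := Nat.exists_eq_add_of_le hjc
      have a1 := D.ord ξ (cfQ α n + i) i (cfP α n) (by push_cast; linarith)
      have a2 := hgt i (by omega) (cfP α n + k) (by push_cast at a1 ⊢; linarith)
      refine a2.le.trans ?_
      rw [← (D.mono_iter (cfQ α n)).le_iff_le, hc2, D.iter_int, ← Function.iterate_add_apply]
      push_cast; linarith

/-- Denjoy inequality (with constant 3) -/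
lemma denjoy (D : CircDyn g α φ τ) (n : ℕ) (x : ℝ) : |Lam g φ (cfQ α n) x| ≤ 3 * τ := by
  obtain ⟨ξ, hξ⟩ := D.exists_lam_zero n
  obtain ⟨j, hj, k, c, hx, hP⟩ := D.cover n x ξ
  have hm := cfQ_mono α D.irr n
  have h1 := D.distort n (cfQ α n) hm c x _ hx hP
  rw [D.lam_int] at h1
  have h2 : |Lam g φ (cfQ α n) (g^[j] ξ)| ≤ 2 * τ := by
    by_cases hjc : j ≤ cfQ α (n+1)
    · have := D.lam_shift n j hjc ξ
      rw [hξ, sub_zero] at this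
      linarith [D.tnn]
    · push Not at hjc
      obtain ⟨i, rfl⟩ := Nat.exists_eq_add_of_le hjc.le
      have a1 := D.lam_shift n _ le_rfl (g^[i] ξ)
      have a2 := D.lam_shift n i (by omega) ξ
      rw [← Function.iterate_add_apply] at a1
      rw [hξ, sub_zero] at a2
      rw [abs_le] at *
      constructor <;> linarith [a1.1, a1.2, a2.1, a2.2]
  rw [abs_le] at *
  constructor <;> linarith [h1.1, h1.2, h2.1, h2.2]

lemma cfIter_sub (D : CircDyn g α φ τ) (n : ℕ) (a b : ℝ) :
    |cfIter g α n a - cfIter g α n b| ≤ Real.exp (3 * τ) * |a - b| ∧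
    |a - b| ≤ Real.exp (3 * τ) * |cfIter g α n a - cfIter g α n b| := by
  wlog hab : a < b generalizing a b
  · rcases (not_lt.1 hab).eq_or_lt with h | h
    · subst h; simp
    · have := this b a h
      rwa [abs_sub_comm, abs_sub_comm b a] at this
  obtain ⟨c, _, hc⟩ := exists_hasDerivAt_eq_slope (cfIter g α n)
    (fun x => Real.exp (Lam g φ (cfQ α n) x)) hab
    (fun x _ => (D.der_cfIter n x).continuousAt.continuousWithinAt)
    (fun x _ => D.der_cfIter n x)
  have hba : 0 < b - a := by linarith
  rw [eq_div_iff hba.ne'] at hc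
  have hd := abs_le.1 (D.denjoy n c)
  rw [abs_sub_comm, abs_sub_comm a b, ← hc, abs_mul, abs_of_pos (Real.exp_pos _)]
  constructor
  · gcongr; exact hd.2
  · rw [← mul_assoc, ← Real.exp_add]
    apply le_mul_of_one_le_left (abs_nonneg _)
    apply Real.one_le_exp
    linarith [hd.1]

lemma mm_succ_le (D : CircDyn g α φ τ) (n : ℕ) (x : ℝ) :
    |mm g α (n+1) x| ≤ Real.exp (3 * τ) * |mm g α n x| := by
  obtain ⟨y, rfl⟩ := D.surj_cfIter n x
  have h1 := (D.cfIter_sub n (cfIter g α n y) y).2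
  refine le_trans ?_ h1
  unfold mm
  have e : cfIter g α (n+1) (cfIter g α n y)
      = g^[cfQ α (n+1) + cfQ α n] y - cfP α n - cfP α (n+1) := by
    unfold cfIter
    rw [D.iter_sub_int, ← Function.iterate_add_apply]
  rcases cfT_signs α D.irr n with ⟨h0, h1, h2⟩ | ⟨h0, h1, h2⟩
  · have a1 := D.cfIter_neg (n+1) (cfIter g α n y) h1
    have a2 := D.ord y 0 (cfQ α (n+1) + cfQ α n) (-cfP α n - cfP α (n+1))
      (by unfold cfT at h2; push_cast; linarith)
    push_cast at a2
    rw [Function.iterate_zero, id] at a2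
    rw [abs_of_neg (by linarith), abs_of_pos (by linarith)]
    linarith
  · have a1 := D.cfIter_pos (n+1) (cfIter g α n y) h1
    have a2 := D.ord y (cfQ α (n+1) + cfQ α n) 0 (cfP α n + cfP α (n+1))
      (by unfold cfT at h2; push_cast; linarith)
    push_cast at a2
    rw [Function.iterate_zero, id] at a2
    rw [abs_of_pos (by linarith), abs_of_neg (by linarith)]
    linarith

lemma mm_iter_succ (D : CircDyn g α φ τ) (n : ℕ) (x : ℝ) :
    |mm g α n (g^[cfQ α (n+1)] x)| ≤ Real.exp (3 * τ) * |mm g α n x| ∧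
    |mm g α n x| ≤ Real.exp (3 * τ) * |mm g α n (g^[cfQ α (n+1)] x)| := by
  have h := D.cfIter_sub (n+1) (cfIter g α n x) x
  have e : cfIter g α (n+1) (cfIter g α n x) - cfIter g α (n+1) x
      = mm g α n (g^[cfQ α (n+1)] x) := by
    unfold mm
    rw [D.cfIter_iter]
    simp only [cfIter]
    ring
  rw [e] at h
  exact h

lemma mm_decay_step (D : CircDyn g α φ τ) (n : ℕ) (x : ℝ) :
    (1 + Real.exp (-(6 * τ))) * |mm g α (n+2) x| ≤ |mm g α n x| := by
  have h1 := D.mm_succ_le (n+1) x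
  have h2 := (D.cfIter_sub n (cfIter g α (n+1) x) x).2
  rw [D.cfIter_comm] at h2
  change |mm g α (n+1) x| ≤ Real.exp (3 * τ) * |mm g α (n+1) (cfIter g α n x)| at h2
  have h3 : |mm g α (n+2) x| + |mm g α (n+1) (cfIter g α n x)| ≤ |mm g α n x| := by
    have hA : (1 : ℝ) ≤ cfA α (n+2) := by exact_mod_cast cfA_pos α D.irr (n+1)
    have hrec := cfT_rec α D.irr n
    have e : cfIter g α (n+1) (cfIter g α n x)
        = g^[cfQ α (n+1) + cfQ α n] x - cfP α n - cfP α (n+1) := by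
      unfold cfIter
      rw [D.iter_sub_int, ← Function.iterate_add_apply]
    unfold mm
    rcases cfT_signs α D.irr n with ⟨h0, h1, h2⟩ | ⟨h0, h1, h2⟩
    · have hs : 0 < cfT α (n+2) := by
        rcases cfT_signs α D.irr (n+1) with ⟨b0, b1, b2⟩ | ⟨b0, b1, b2⟩
        · linarith
        · exact b1
      have a0 := D.cfIter_pos n x h0
      have a1 := D.cfIter_neg (n+1) (cfIter g α n x) h1
      have a2 := D.cfIter_pos (n+2) x hs
      have a3 := D.ord_le x (cfQ α (n+2)) (cfQ α (n+1) + cfQ α n)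
        (cfP α (n+2) - cfP α n - cfP α (n+1))
        (by
          have : cfT α (n+2) ≤ cfT α n + cfT α (n+1) := by rw [hrec]; nlinarith
          unfold cfT at this; push_cast; linarith)
      push_cast at a3
      rw [abs_of_pos (by linarith), abs_of_neg (by linarith), abs_of_pos (by linarith), e]
      have : cfIter g α (n+2) x = g^[cfQ α (n+2)] x - cfP α (n+2) := rfl
      linarith
    · have hs : cfT α (n+2) < 0 := by
        rcases cfT_signs α D.irr (n+1) with ⟨b0, b1, b2⟩ | ⟨b0, b1, b2⟩
        · exact b1
        · linarith
      have a0 := D.cfIter_neg n x h0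
      have a1 := D.cfIter_pos (n+1) (cfIter g α n x) h1
      have a2 := D.cfIter_neg (n+2) x hs
      have a3 := D.ord_le x (cfQ α (n+1) + cfQ α n) (cfQ α (n+2))
        (-cfP α (n+2) + cfP α n + cfP α (n+1))
        (by
          have : cfT α n + cfT α (n+1) ≤ cfT α (n+2) := by rw [hrec]; nlinarith
          unfold cfT at this; push_cast; linarith)
      push_cast at a3
      rw [abs_of_neg (by linarith), abs_of_pos (by linarith), abs_of_neg (by linarith), e]
      have : cfIter g α (n+2) x = g^[cfQ α (n+2)] x - cfP α (n+2) := rfl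
      linarith
  have h4 : |mm g α (n+2) x| ≤ Real.exp (6 * τ) * |mm g α (n+1) (cfIter g α n x)| := by
    calc |mm g α (n+2) x| ≤ Real.exp (3 * τ) * |mm g α (n+1) x| := h1
      _ ≤ Real.exp (3 * τ) * (Real.exp (3 * τ) * |mm g α (n+1) (cfIter g α n x)|) := by gcongr
      _ = _ := by rw [← mul_assoc, ← Real.exp_add]; congr 2; ring
  have h5 : Real.exp (-(6 * τ)) * |mm g α (n+2) x| ≤ |mm g α (n+1) (cfIter g α n x)| := by
    rw [Real.exp_neg, inv_mul_le_iff₀ (Real.exp_pos _)]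
    exact h4
  linarith

lemma mm_small (D : CircDyn g α φ τ) (ε : ℝ) (hε : 0 < ε) :
    ∃ n₀ : ℕ, ∀ n ≥ n₀, ∀ x, |mm g α n x| < ε := by
  set r := 1 + Real.exp (-(6 * τ)) with hr
  have hr1 : 1 < r := by have := Real.exp_pos (-(6 * τ)); linarith
  have hb : ∀ j n : ℕ, ∀ x, r ^ j * |mm g α (n + 2 * j) x| ≤ 1 := by
    intro j
    induction j with
    | zero => intro n x; simpa using D.mm_le_one n x
    | succ j ih =>
      intro n x
      have h1 := D.mm_decay_step (n + 2 * j) x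
      calc r ^ (j+1) * |mm g α (n + 2 * (j+1)) x|
          = r ^ j * (r * |mm g α (n + 2 * j + 2) x|) := by
            rw [show n + 2 * (j+1) = n + 2 * j + 2 by ring]; ring
        _ ≤ r ^ j * |mm g α (n + 2 * j) x| := by
            apply mul_le_mul_of_nonneg_left h1; positivity
        _ ≤ 1 := ih n x
  obtain ⟨J, hJ⟩ := pow_unbounded_of_one_lt (1 / ε) hr1
  refine ⟨2 * J, fun n hn x => ?_⟩
  obtain ⟨i, rfl⟩ := Nat.exists_eq_add_of_le hn
  have := hb J i x
  rw [add_comm i] at this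
  rw [div_lt_iff₀ hε] at hJ
  by_contra hcon
  push Not at hcon
  have hp : 0 < r ^ J := by positivity
  nlinarith

end CircDyn

/-! ### Complex part -/

lemma mul_near_one {u v : ℂ} {a b : ℝ} (hu : ‖u - 1‖ ≤ Real.exp a - 1)
    (hv : ‖v - 1‖ ≤ Real.exp b - 1) : ‖u * v - 1‖ ≤ Real.exp (a + b) - 1 := by
  have e : u * v - 1 = (u - 1) * (v - 1) + (u - 1) + (v - 1) := by ring
  rw [e, Real.exp_add]
  have h1 : ‖(u - 1) * (v - 1)‖ ≤ (Real.exp a - 1) * (Real.exp b - 1) := by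
    rw [norm_mul]
    exact mul_le_mul hu hv (norm_nonneg _) ((norm_nonneg _).trans hu)
  have h2 := norm_add₃_le (a := (u - 1) * (v - 1)) (b := u - 1) (c := v - 1)
  nlinarith

lemma exp_near_one (w : ℂ) : ‖Complex.exp w - 1‖ ≤ Real.exp ‖w‖ - 1 := by
  simpa using Complex.norm_exp_sub_sum_le_exp_norm_sub_sum w 1

section
variable {Δ : ℝ} {g : ℝ → ℝ} {G : ℂ → ℂ} {τ : ℝ}

lemma strip_convex (Δ : ℝ) : Convex ℝ {z : ℂ | |z.im| < Δ} := by
  have : {z : ℂ | |z.im| < Δ} = Complex.imLm ⁻¹' (Set.Ioo (-Δ) Δ) := by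
    ext z; simp [abs_lt]
  rw [this]
  exact (convex_Ioo _ _).linear_preimage _

lemma strip_open (Δ : ℝ) : IsOpen {z : ℂ | |z.im| < Δ} :=
  isOpen_lt (by fun_prop) continuous_const

lemma log_lip (hG : DifferentiableOn ℂ G {z : ℂ | |z.im| < Δ})
    (hRe : ∀ z : ℂ, |z.im| < Δ → 0 < (deriv G z).re)
    (hτ : ∀ z : ℂ, |z.im| < Δ → ‖iteratedDeriv 2 G z / deriv G z‖ ≤ τ)
    {z w : ℂ} (hz : |z.im| < Δ) (hw : |w.im| < Δ) :
    ‖Complex.log (deriv G z) - Complex.log (deriv G w)‖ ≤ τ * ‖z - w‖ := by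
  refine Convex.norm_image_sub_le_of_norm_hasDerivWithin_le
    (f := fun z => Complex.log (deriv G z)) (f' := fun z => iteratedDeriv 2 G z / deriv G z)
    (s := {z : ℂ | |z.im| < Δ}) ?_ hτ (strip_convex Δ) hw hz
  intro x hx
  apply HasDerivAt.hasDerivWithinAt
  have h1 : DifferentiableAt ℂ (deriv G) x :=
    (hG.deriv (strip_open Δ)).differentiableAt ((strip_open Δ).mem_nhds hx)
  have h2 : iteratedDeriv 2 G x = deriv (deriv G) x := by
    rw [iteratedDeriv_succ, iteratedDeriv_one]
  rw [h2]
  exact h1.hasDerivAt.clog (Or.inl (hRe x hx))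

lemma complex_step (hG : DifferentiableOn ℂ G {z : ℂ | |z.im| < Δ})
    (hRe : ∀ z : ℂ, |z.im| < Δ → 0 < (deriv G z).re)
    (hτ : ∀ z : ℂ, |z.im| < Δ → ‖iteratedDeriv 2 G z / deriv G z‖ ≤ τ) (hτ0 : 0 ≤ τ)
    {z w : ℂ} (hz : |z.im| < Δ) (hw : |w.im| < Δ) :
    ∃ v : ℂ, G z - G w = deriv G w * (z - w) * v ∧ ‖v - 1‖ ≤ Real.exp (τ * ‖z - w‖) - 1 := by
  by_cases hzw : z = w
  · subst hzw; exact ⟨1, by simp, by simp⟩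
  have hne : z - w ≠ 0 := sub_ne_zero.2 hzw
  have ha : ∀ z : ℂ, |z.im| < Δ → deriv G z ≠ 0 := fun z hz h => by
    have := hRe z hz; rw [h] at this; simp at this
  have haw := ha w hw
  refine ⟨(G z - G w) / (deriv G w * (z - w)), by field_simp, ?_⟩
  have key := Convex.norm_image_sub_le_of_norm_hasDerivWithin_le
    (f := fun y => G y / deriv G w - y) (f' := fun y => deriv G y / deriv G w - 1)
    (s := segment ℝ w z) (x := w) (y := z) (C := Real.exp (τ * ‖z - w‖) - 1) ?_ ?_
    (convex_segment _ _) (left_mem_segment _ _ _) (right_mem_segment _ _ _)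
  · have e : (G z - G w) / (deriv G w * (z - w)) - 1
        = ((G z / deriv G w - z) - (G w / deriv G w - w)) / (z - w) := by
      field_simp; ring
    rw [e, norm_div, div_le_iff₀ (norm_pos_iff.2 hne)]
    exact key
  · intro y hy
    have hyS : |y.im| < Δ := (strip_convex Δ).segment_subset hw hz hy
    have := (hG.differentiableAt ((strip_open Δ).mem_nhds hyS)).hasDerivAt
    exact ((this.div_const _).sub (hasDerivAt_id y)).hasDerivWithinAt
  · intro y hy
    have hyS : |y.im| < Δ := (strip_convex Δ).segment_subset hw hz hy
    have h1 := log_lip hG hRe hτ hyS hw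
    have h2 : deriv G y / deriv G w
        = Complex.exp (Complex.log (deriv G y) - Complex.log (deriv G w)) := by
      rw [Complex.exp_sub, Complex.exp_log (ha y hyS), Complex.exp_log haw]
    rw [h2]
    refine (exp_near_one _).trans ?_
    have h3 : ‖y - w‖ ≤ ‖z - w‖ := by
      obtain ⟨t, ht, rfl⟩ := (segment_eq_image' ℝ w z ▸ hy)
      simp only [add_sub_cancel_left, norm_smul, Real.norm_eq_abs, abs_of_nonneg ht.1]
      exact mul_le_of_le_one_left (norm_nonneg _) ht.2
    gcongr
    exact h1.trans (by gcongr)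

lemma real_deriv (hΔ : 0 < Δ) (hG : DifferentiableOn ℂ G {z : ℂ | |z.im| < Δ})
    (hRe : ∀ z : ℂ, |z.im| < Δ → 0 < (deriv G z).re)
    (hGreal : ∀ x : ℝ, G (x : ℂ) = ((g x : ℝ) : ℂ)) (x : ℝ) :
    HasDerivAt g (Real.exp ((Complex.log (deriv G x)).re)) x ∧
    deriv G x = ((Real.exp ((Complex.log (deriv G x)).re) : ℝ) : ℂ) := by
  have hx : |(x : ℂ).im| < Δ := by simpa using hΔ
  have h0 := (hG.differentiableAt ((strip_open Δ).mem_nhds hx)).hasDerivAt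
  have h1 : HasDerivAt g (deriv G x).re x := by
    have := h0.real_of_complex
    simpa [hGreal] using this
  have h2 : deriv G x = (((deriv G x).re : ℝ) : ℂ) := by
    have a1 := h0.comp_ofReal
    have a2 := h1.ofReal_comp
    simp only [hGreal] at a1
    exact a1.unique a2
  have h3 : Real.exp ((Complex.log (deriv G x)).re) = (deriv G x).re := by
    have hp := hRe x hx
    rw [h2, ← Complex.ofReal_log (by simpa using hp.le)]
    simp only [Complex.ofReal_re]
    exact Real.exp_log hp
  rw [h3]
  exact ⟨h1, h2⟩

lemma mk_circDyn (hΔ : 0 < Δ) (hG : DifferentiableOn ℂ G {z : ℂ | |z.im| < Δ})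
    (hRe : ∀ z : ℂ, |z.im| < Δ → 0 < (deriv G z).re)
    (hGreal : ∀ x : ℝ, G (x : ℂ) = ((g x : ℝ) : ℂ))
    (hτ : ∀ z : ℂ, |z.im| < Δ → ‖iteratedDeriv 2 G z / deriv G z‖ ≤ τ)
    (hgmono : StrictMono g) (hgsurj : Function.Surjective g)
    (hgper : ∀ x : ℝ, g (x + 1) = g x + 1)
    (α : ℝ) (hα : Irrational α)
    (hrot : ∀ x : ℝ, Tendsto (fun m : ℕ => (g^[m] x - x) / m) atTop (𝓝 α)) :
    CircDyn g α (fun x => (Complex.log (deriv G (x : ℂ))).re) τ where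
  irr := hα
  mono := hgmono
  surj := hgsurj
  per := hgper
  ord := by
    intro x i j k h
    let f : CircleDeg1Lift := ⟨⟨g, hgmono.monotone⟩, hgper⟩
    have hf : ⇑f = g := rfl
    have hτf : f.translationNumber = α := by
      refine tendsto_nhds_unique (f.tendsto_translationNumber 0) ?_
      have := hrot 0
      simpa [CircleDeg1Lift.coe_pow, hf] using this
    rcases le_total i j with hij | hij
    · obtain ⟨d, rfl⟩ := Nat.exists_eq_add_of_le hij
      have h1 := (f ^ d).lt_map_of_int_lt_translationNumber (n := -k)
        (by rw [CircleDeg1Lift.translationNumber_pow, hτf]; push_cast at h ⊢; linarith) (g^[i] x)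
      rw [CircleDeg1Lift.coe_pow, hf, ← Function.iterate_add_apply, add_comm d i] at h1
      push_cast at h1; linarith
    · obtain ⟨d, rfl⟩ := Nat.exists_eq_add_of_le hij
      have h1 := (f ^ d).map_lt_of_translationNumber_lt_int (n := k)
        (by rw [CircleDeg1Lift.translationNumber_pow, hτf]; push_cast at h ⊢; linarith) (g^[j] x)
      rw [CircleDeg1Lift.coe_pow, hf, ← Function.iterate_add_apply, add_comm d j] at h1
      exact h1
  der := fun x => (real_deriv hΔ hG hRe hGreal x).1
  phiper := by
    intro x
    have h1 := (real_deriv hΔ hG hRe hGreal x).1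
    have h2 := (real_deriv hΔ hG hRe hGreal (x+1)).1
    have h3 := h2.comp_add_const x 1
    have h4 := h1.add_const 1
    simp only [hgper] at h3
    exact Real.exp_injective (h3.unique h4)
  lip := by
    intro x y
    have := log_lip hG hRe hτ (z := (x:ℂ)) (w := (y:ℂ)) (by simpa using hΔ) (by simpa using hΔ)
    rw [← Complex.ofReal_sub, Complex.norm_real, Real.norm_eq_abs] at this
    refine le_trans ?_ this
    rw [← Complex.sub_re]
    exact Complex.abs_re_le_norm _
  tnn := (norm_nonneg _).trans (hτ 0 (by simpa using hΔ))

end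

lemma real_step {g : ℝ → ℝ} {α : ℝ} {φ : ℝ → ℝ} {τ : ℝ} (D : CircDyn g α φ τ) (x y : ℝ) :
    ∃ b : ℝ, |b| ≤ τ * |y - x| ∧ g y - g x = Real.exp (φ x) * Real.exp b * (y - x) := by
  have main : ∀ x y : ℝ, x < y → ∃ c ∈ Set.uIcc x y, g y - g x = Real.exp (φ c) * (y - x) := by
    intro x y h
    obtain ⟨c, hc, h1⟩ := exists_hasDerivAt_eq_slope g (fun x => Real.exp (φ x)) h
      (fun x _ => (D.der x).continuousAt.continuousWithinAt) (fun x _ => D.der x)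
    refine ⟨c, Set.mem_uIcc.2 (Or.inl ⟨hc.1.le, hc.2.le⟩), ?_⟩
    rw [eq_div_iff (by linarith)] at h1
    exact h1.symm
  obtain ⟨c, hc, h⟩ : ∃ c ∈ Set.uIcc x y, g y - g x = Real.exp (φ c) * (y - x) := by
    rcases lt_trichotomy x y with h | h | h
    · exact main x y h
    · subst h; exact ⟨x, Set.left_mem_uIcc, by simp⟩
    · obtain ⟨c, hc, h1⟩ := main y x h
      exact ⟨c, Set.uIcc_comm x y ▸ hc, by linarith⟩
  refine ⟨φ c - φ x, (D.lip c x).trans ?_, ?_⟩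
  · apply mul_le_mul_of_nonneg_left _ D.tnn
    exact Set.abs_sub_left_of_mem_uIcc hc
  · rw [h, ← Real.exp_add]; congr 2; ring

lemma exp_third_le : Real.exp (1/3) ≤ 3/2 := by
  have h1 : Real.exp (1/3) ^ 3 = Real.exp 1 := by
    rw [← Real.exp_nat_mul]; norm_num
  have h2 := Real.exp_one_lt_d9
  by_contra h
  push Not at h
  have : (3/2 : ℝ) ^ 3 < Real.exp (1/3) ^ 3 := by gcongr
  rw [h1] at this
  norm_num at this
  linarith

lemma orbit_control {Δ : ℝ} {g : ℝ → ℝ} {G : ℂ → ℂ} {τ α : ℝ}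
    (hΔ : 0 < Δ) (hG : DifferentiableOn ℂ G {z : ℂ | |z.im| < Δ})
    (hRe : ∀ z : ℂ, |z.im| < Δ → 0 < (deriv G z).re)
    (hGreal : ∀ x : ℝ, G (x : ℂ) = ((g x : ℝ) : ℂ))
    (hτ : ∀ z : ℂ, |z.im| < Δ → ‖iteratedDeriv 2 G z / deriv G z‖ ≤ τ)
    (hτs : τ < 1 / 9)
    (D : CircDyn g α (fun x => (Complex.log (deriv G (x : ℂ))).re) τ)
    (y₀ : ℝ) (hy0 : 0 < y₀) (hy1 : y₀ < 1) (n : ℕ)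
    (hsmall : ∀ x, |mm g α n x| < Δ / 2) (x : ℝ) (i : ℕ) (hi : i ≤ cfQ α (n + 1)) :
    ∃ u : ℂ, G^[i] (liftPt g α n y₀ x) - ((g^[i] x : ℝ) : ℂ)
        = Complex.I * y₀ * (|mm g α n (g^[i] x)| : ℝ) * u ∧
      ‖u - 1‖ ≤ Real.exp ((∑ j ∈ Finset.range i, |mm g α n (g^[j] x)|) * (1/3)) - 1 := by
  induction i with
  | zero =>
    refine ⟨1, ?_, by simp⟩
    simp only [Function.iterate_zero, id, liftPt, mm]
    ring
  | succ i ih =>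
    obtain ⟨u, hu, hun⟩ := ih (by omega)
    set ℓ := |mm g α n (g^[i] x)| with hℓ
    set S := ∑ j ∈ Finset.range i, |mm g α n (g^[j] x)| with hS
    set z := G^[i] (liftPt g α n y₀ x) with hz
    set t := g^[i] x with ht
    have hSle : S ≤ 1 := D.sum_mm' n i (by omega) x
    have hℓ0 : 0 ≤ ℓ := abs_nonneg _
    have hexp : Real.exp (S * (1/3)) ≤ 3/2 :=
      (Real.exp_le_exp.2 (by linarith)).trans exp_third_le
    have hu2 : ‖u‖ ≤ 3/2 := by
      have : ‖u‖ ≤ ‖u - 1‖ + ‖(1:ℂ)‖ := by simpa using norm_add_le (u - 1) 1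
      rw [norm_one] at this
      linarith
    have hδ : ‖z - (t : ℂ)‖ ≤ 3/2 * ℓ := by
      rw [hu]
      simp only [norm_mul, Complex.norm_I, one_mul, Complex.norm_real, Real.norm_eq_abs,
        abs_of_pos hy0, abs_of_nonneg hℓ0]
      have : y₀ * ℓ ≤ ℓ := mul_le_of_le_one_left hℓ0 hy1.le
      have h2 : y₀ * ℓ * ‖u‖ ≤ ℓ * (3/2) :=
        mul_le_mul this hu2 (norm_nonneg _) hℓ0
      linarith
    have hzS : |z.im| < Δ := by
      have h1 := Complex.abs_im_le_norm (z - (t:ℂ))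
      simp only [Complex.sub_im, Complex.ofReal_im, sub_zero] at h1
      have := hsmall t
      linarith
    have htS : |(t : ℂ).im| < Δ := by simpa using hΔ
    obtain ⟨v, hv, hvn⟩ := complex_step hG hRe hτ D.tnn hzS htS
    obtain ⟨b, hb, hgb⟩ := real_step D t (cfIter g α n t)
    have hda := (real_deriv hΔ hG hRe hGreal t).2
    set a := Real.exp ((Complex.log (deriv G (t : ℂ))).re) with ha
    have ha0 : 0 < a := Real.exp_pos _
    have hmm : |mm g α n (g t)| = a * Real.exp b * ℓ := by
      have e : mm g α n (g t) = g (cfIter g α n t) - g t := by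
        unfold mm
        have := D.cfIter_iter n 1 t
        simp only [Function.iterate_one] at this
        rw [this]
      rw [e, hgb, abs_mul, abs_of_pos (by positivity)]
      rfl
    refine ⟨u * v * Complex.exp (((-b : ℝ)) : ℂ), ?_, ?_⟩
    · rw [Function.iterate_succ_apply', Function.iterate_succ_apply', ← hz, ← ht, ← hGreal, hv,
        hda, hu, hmm]
      have : Complex.exp ((b : ℝ) : ℂ) * Complex.exp ((-b : ℝ) : ℂ) = 1 := by
        rw [← Complex.exp_add]; simp
      push_cast at this ⊢
      linear_combination (-(a : ℂ) * Complex.I * y₀ * ℓ * u * v) * this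
    · have h1 : ‖Complex.exp ((-b : ℝ) : ℂ) - 1‖ ≤ Real.exp (τ * ℓ) - 1 := by
        refine (exp_near_one _).trans ?_
        rw [Complex.norm_real, Real.norm_eq_abs, abs_neg]
        gcongr
        exact hb
      have h2 := mul_near_one (mul_near_one hun hvn) h1
      refine h2.trans ?_
      rw [Finset.sum_range_succ, ← hS, ← ht, ← hℓ]
      gcongr
      have h3 : τ * ‖z - (t:ℂ)‖ ≤ 1/9 * (3/2 * ℓ) := by
        apply mul_le_mul hτs.le hδ (norm_nonneg _) (by norm_num)
      have h4 : τ * ℓ ≤ 1/9 * ℓ := by gcongr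
      linarith

/-- **Almost-periodicity along the quasi-invariant curves.**
Let `g ∈ D^ω(𝕋,Δ)` with holomorphic extension `G` to the strip `B_Δ`, `Re G′ > 0` on `B_Δ`,
irrational rotation number `α`, nonlinearity `τ = sup_{B_Δ} |(log g′)′| < 1/9`, and fix
`1/2 < y₀ < 1`.  There are `C₀ > 0` and `n₀ ≥ 1` such that for all `n ≥ n₀` and every point
`z₀ = x₀ + i |mₙ(x₀)| y₀` of the curve, `d_P(z₀, G^{q_{n+1}}(z₀) − p_{n+1}) ≤ C₀`. -/
theorem return_map_hyperbolically_close_to_identity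
    (Δ : ℝ) (hΔ : 0 < Δ)
    (g : ℝ → ℝ) (G : ℂ → ℂ) (V : Set ℂ)
    (hVopen : IsOpen V) (hVΔ : closure {z : ℂ | |z.im| < Δ} ⊆ V)
    (hVshift : ∀ z : ℂ, z ∈ V ↔ z + 1 ∈ V)
    (hGholo : DifferentiableOn ℂ G V) (hGinj : Set.InjOn G V)
    (hGonto : closure {z : ℂ | |z.im| < Δ} ⊆ G '' V)
    (hGreal : ∀ x : ℝ, G (x : ℂ) = ((g x : ℝ) : ℂ))
    (hgmono : StrictMono g) (hgsurj : Function.Surjective g)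
    (hgper : ∀ x : ℝ, g (x + 1) = g x + 1)
    (hGper : ∀ z ∈ V, G (z + 1) = G z + 1)
    (hRe : ∀ z : ℂ, |z.im| < Δ → 0 < (deriv G z).re)
    (α : ℝ) (hα : Irrational α)
    (hrot : ∀ x : ℝ, Tendsto (fun m : ℕ => (g^[m] x - x) / m) atTop (𝓝 α))
    (τ : ℝ) (hτsmall : τ < 1 / 9)
    (hτ : ∀ z : ℂ, |z.im| < Δ → ‖iteratedDeriv 2 G z / deriv G z‖ ≤ τ)
    (y₀ : ℝ) (hy₀ : 1 / 2 < y₀) (hy₀1 : y₀ < 1) :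
    ∃ C₀ > (0 : ℝ), ∃ n₀ : ℕ, 1 ≤ n₀ ∧ ∀ n ≥ n₀, ∀ x₀ : ℝ,
      ∃ (h : 0 < (liftPt g α n y₀ x₀).im)
        (h' : 0 < (G^[cfQ α (n + 1)] (liftPt g α n y₀ x₀) - ((cfP α (n + 1) : ℝ) : ℂ)).im),
        dist (⟨liftPt g α n y₀ x₀, h⟩ : UpperHalfPlane)
          (⟨G^[cfQ α (n + 1)] (liftPt g α n y₀ x₀) - ((cfP α (n + 1) : ℝ) : ℂ), h'⟩ :
            UpperHalfPlane) ≤ C₀ := by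
  have hG : DifferentiableOn ℂ G {z : ℂ | |z.im| < Δ} :=
    hGholo.mono (subset_closure.trans hVΔ)
  have D := mk_circDyn hΔ hG hRe hGreal hτ hgmono hgsurj hgper α hα hrot
  obtain ⟨n₀, hn₀⟩ := D.mm_small (Δ / 2) (by linarith)
  set E := Real.exp (3 * τ) with hE
  have hE1 : 1 ≤ E := Real.one_le_exp (by linarith [D.tnn])
  refine ⟨2 * Real.arsinh (16 * E ^ 2), ?_, n₀ + 1, by omega, ?_⟩
  · have : 0 < Real.arsinh (16 * E ^ 2) := Real.arsinh_pos_iff.2 (by positivity)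
    linarith
  intro n hn x
  obtain ⟨u, hu, hun⟩ := orbit_control hΔ hG hRe hGreal hτ hτsmall D y₀ (by linarith) hy₀1 n
    (hn₀ n (by omega)) x _ le_rfl
  have hS := D.sum_mm n x
  set S := ∑ j ∈ Finset.range (cfQ α (n + 1)), |mm g α n (g^[j] x)|
  have hun2 : ‖u - 1‖ ≤ 1/2 := by
    have := (Real.exp_le_exp.2 (by linarith : S * (1/3) ≤ 1/3)).trans exp_third_le
    linarith
  obtain ⟨hc1, hc2⟩ := D.mm_iter_succ n x
  have hm := D.mm_succ_le n x
  set ℓ := |mm g α n x| with hℓ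
  set ℓ' := |mm g α n (g^[cfQ α (n+1)] x)| with hℓ'
  have hℓ0 : 0 < ℓ := abs_pos.2 (D.mm_ne n x)
  have hℓ0' : 0 < ℓ' := abs_pos.2 (D.mm_ne n _)
  have hz0 : liftPt g α n y₀ x = (x : ℂ) + Complex.I * (ℓ : ℂ) * (y₀ : ℂ) := rfl
  have hw : G^[cfQ α (n + 1)] (liftPt g α n y₀ x) - ((cfP α (n + 1) : ℝ) : ℂ)
      = ((cfIter g α (n+1) x : ℝ) : ℂ) + Complex.I * y₀ * ℓ' * u := by
    rw [← hu]; unfold cfIter; push_cast; ring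
  have hure : 1/2 ≤ u.re := by
    have := (Complex.abs_re_le_norm (u - 1)).trans hun2
    rw [abs_le] at this
    simp at this
    linarith [this.1]
  have hunorm : ‖u‖ ≤ 3/2 := by
    have : ‖u‖ ≤ ‖u - 1‖ + ‖(1:ℂ)‖ := by simpa using norm_add_le (u - 1) 1
    rw [norm_one] at this
    linarith
  have him0 : (liftPt g α n y₀ x).im = ℓ * y₀ := by
    rw [hz0]; simp
  have him1 : (G^[cfQ α (n + 1)] (liftPt g α n y₀ x) - ((cfP α (n + 1) : ℝ) : ℂ)).im
      = y₀ * ℓ' * u.re := by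
    rw [hw]; simp
  have p0 : 0 < ℓ * y₀ := by positivity
  have p1 : 0 < y₀ * ℓ' * u.re := by positivity
  refine ⟨by rw [him0]; exact p0, by rw [him1]; exact p1, ?_⟩
  rw [UpperHalfPlane.dist_eq]
  have hdist : dist (liftPt g α n y₀ x)
      (G^[cfQ α (n + 1)] (liftPt g α n y₀ x) - ((cfP α (n + 1) : ℝ) : ℂ)) ≤ 4 * E * ℓ := by
    rw [dist_comm, dist_eq_norm, hw, hz0]
    have e : ((cfIter g α (n+1) x : ℝ) : ℂ) + Complex.I * y₀ * ℓ' * u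
        - ((x : ℂ) + Complex.I * (ℓ : ℂ) * (y₀ : ℂ))
        = ((mm g α (n+1) x : ℝ) : ℂ) + Complex.I * y₀ * ℓ' * u
          + (-(Complex.I * (ℓ : ℂ) * (y₀ : ℂ))) := by
      unfold mm; push_cast; ring
    rw [e]
    refine norm_add₃_le.trans ?_
    simp only [norm_neg, norm_mul, Complex.norm_I, one_mul, Complex.norm_real, Real.norm_eq_abs,
      abs_of_pos hℓ0, abs_of_pos hℓ0', abs_of_pos (by linarith : 0 < y₀)]
    have a1 : y₀ * ℓ' * ‖u‖ ≤ (E * ℓ) * (3/2) := by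
      apply mul_le_mul _ hunorm (norm_nonneg _) (by positivity)
      exact (mul_le_of_le_one_left hℓ0'.le hy₀1.le).trans hc1
    have a2 : ℓ * y₀ ≤ ℓ := mul_le_of_le_one_right hℓ0.le hy₀1.le
    have a3 : ℓ ≤ E * ℓ := le_mul_of_one_le_left hℓ0.le hE1
    nlinarith
  have hsqrt : ℓ / (8 * E) ≤ √((ℓ * y₀) * (y₀ * ℓ' * u.re)) := by
    apply Real.le_sqrt_of_sq_le
    have b1 : ℓ / 2 ≤ ℓ * y₀ := by nlinarith
    have b2 : ℓ' / 4 ≤ y₀ * ℓ' * u.re := by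
      have : 1/2 * ℓ' ≤ y₀ * ℓ' := by gcongr
      nlinarith [mul_le_mul this hure (by norm_num) (by positivity)]
    have b3 : ℓ / E ≤ ℓ' := by rw [div_le_iff₀ (by positivity)]; linarith
    calc (ℓ / (8 * E)) ^ 2 = (ℓ * (ℓ / E)) * (1 / (64 * E)) := by field_simp; norm_num
      _ ≤ (ℓ * (ℓ / E)) * (1 / 8) := by
          gcongr
          linarith
      _ ≤ (ℓ * ℓ') * (1 / 8) := by gcongr
      _ = (ℓ / 2) * (ℓ' / 4) := by ring
      _ ≤ _ := by gcongr
  have hfin : dist (liftPt g α n y₀ x)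
      (G^[cfQ α (n + 1)] (liftPt g α n y₀ x) - ((cfP α (n + 1) : ℝ) : ℂ)) /
      (2 * √((ℓ * y₀) * (y₀ * ℓ' * u.re))) ≤ 16 * E ^ 2 := by
    rw [div_le_iff₀ (by positivity)]
    refine hdist.trans ?_
    calc 4 * E * ℓ = 16 * E ^ 2 * (2 * (ℓ / (8 * E))) := by field_simp; norm_num
      _ ≤ _ := by gcongr
  rw [← him0, ← him1] at hfin
  have := Real.arsinh_le_arsinh.2 hfin
  exact mul_le_mul_of_nonneg_left this (by norm_num)
end

section
/- Assume τ := sup_{z∈B_Δ} |(log g′)′(z)| < 1/9 and fix y₀ with 1/2 < y₀ < 1. There exist a constant C₀ > 0 and n₀ ≥ 1 such that for all n ≥ n₀, setting Γₙ = {x + i·|mₙ(x)|·y₀ : x ∈ ℝ} ⊂ ℍ, for every 0 ≤ j ≤ q_{n+1} the image g^j(Γₙ) is contained in ℍ and the Hausdorff distance, with respect to the Poincaré distance d_P of the upper half-plane ℍ, between g^j(Γₙ) and Γₙ is at most 2C₀: every point of g^j(Γₙ) is within d_P-distance 2C₀ of Γₙ and every point of Γₙ is within d_P-distance 2C₀ of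 g^j(Γₙ). -/
open Filter Topology

lemma qic_prod (τ : ℝ) (d u : ℕ → ℂ) (j : ℕ)
    (h : ∀ l < j, ‖u (l+1) - d l * u l‖ ≤ ‖d l‖ * ‖u l‖ * (Real.exp (τ * ‖u l‖) - 1)) :
    ‖u j - (∏ l ∈ Finset.range j, d l) * u 0‖ ≤
      ‖∏ l ∈ Finset.range j, d l‖ * ‖u 0‖ *
        (Real.exp (τ * ∑ l ∈ Finset.range j, ‖u l‖) - 1) := by
  induction j with
  | zero => simp
  | succ j ih =>
    have ih := ih (fun l hl => h l (by omega))
    have h := h j (by omega)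
    rw [Finset.prod_range_succ, Finset.sum_range_succ, mul_add, Real.exp_add, norm_mul]
    set D := ∏ l ∈ Finset.range j, d l
    set E := Real.exp (τ * ∑ l ∈ Finset.range j, ‖u l‖)
    set e := Real.exp (τ * ‖u j‖)
    have h1 : ‖u j‖ ≤ ‖D‖ * ‖u 0‖ * E := by
      have : ‖u j‖ ≤ ‖u j - D * u 0‖ + ‖D * u 0‖ := norm_le_norm_sub_add _ _
      rw [norm_mul] at this
      linarith
    have he : 0 ≤ ‖d j‖ := norm_nonneg _
    have h2 : u (j+1) - D * d j * u 0 = (u (j+1) - d j * u j) + d j * (u j - D * u 0) := by ring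
    have h3 : ‖u (j+1) - d j * u j‖ ≤ ‖d j‖ * (e * ‖u j‖) - ‖d j‖ * ‖u j‖ := by linarith
    have h4 : ‖d j * (u j - D * u 0)‖ ≤ ‖d j‖ * (‖D‖ * ‖u 0‖ * (E - 1)) := by
      rw [norm_mul]; gcongr
    rw [h2]
    refine (norm_add_le _ _).trans ?_
    by_cases hτ : 1 ≤ e
    · have : ‖d j‖ * ‖u j‖ * (e - 1) ≤ ‖d j‖ * (‖D‖ * ‖u 0‖ * E) * (e - 1) := by
        gcongr
      linarith
    · have : 0 ≤ ‖u (j+1) - d j * u j‖ := norm_nonneg _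
      have h5 : ‖d j‖ * ‖u j‖ = 0 := by
        have : 0 ≤ ‖d j‖ * ‖u j‖ := by positivity
        nlinarith
      have h6 : ‖u j‖ = 0 ∨ ‖d j‖ = 0 := by
        rcases mul_eq_zero.1 h5 with h | h <;> simp [h]
      rcases h6 with h6 | h6
      · exfalso; apply hτ; simp [e, h6]
      · rw [h6] at h4 h
        simp only [h6]
        linarith

lemma qic_exp1 {t : ℝ} (h : t ≤ 1/9) : Real.exp t - 1 ≤ 1/8 := by
  have : Real.exp t ≤ Real.exp (1/9) := Real.exp_le_exp.2 h
  have h2 := Real.add_one_le_exp (-(1/9 : ℝ))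
  rw [Real.exp_neg] at h2
  have h3 : 0 < Real.exp (1/9) := Real.exp_pos _
  have : Real.exp (1/9) ≤ 9/8 := by
    have := mul_le_mul_of_nonneg_left h2 h3.le
    rw [mul_inv_cancel₀ h3.ne'] at this
    linarith
  linarith

lemma qic_exp2 {t : ℝ} (h : t ≤ 2/9) : Real.exp t - 1 ≤ 2/7 := by
  have : Real.exp t ≤ Real.exp (2/9) := Real.exp_le_exp.2 h
  have h2 := Real.add_one_le_exp (-(2/9 : ℝ))
  rw [Real.exp_neg] at h2
  have h3 : 0 < Real.exp (2/9) := Real.exp_pos _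
  have : Real.exp (2/9) ≤ 9/7 := by
    have := mul_le_mul_of_nonneg_left h2 h3.le
    rw [mul_inv_cancel₀ h3.ne'] at this
    linarith
  linarith

lemma qic_compare (τ : ℝ) (hτ0 : 0 ≤ τ) (hτ : τ ≤ 1/9) (d s u : ℕ → ℂ) (j : ℕ)
    (hs : ∀ l < j, ‖s (l+1) - d l * s l‖ ≤ ‖d l‖ * ‖s l‖ * (Real.exp (τ * ‖s l‖) - 1))
    (hu : ∀ l < j, ‖u l‖ ≤ 2 * ‖s l‖ →
      ‖u (l+1) - d l * u l‖ ≤ ‖d l‖ * ‖u l‖ * (Real.exp (τ * ‖u l‖) - 1))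
    (hsum : ∑ l ∈ Finset.range j, ‖s l‖ ≤ 1) (h0 : ‖u 0‖ ≤ ‖s 0‖) :
    ∀ i ≤ j, ‖u i‖ ≤ 2 * ‖s i‖ ∧
      ‖u i - (∏ l ∈ Finset.range i, d l) * u 0‖ ≤
        ‖∏ l ∈ Finset.range i, d l‖ * ‖u 0‖ * (2/7) ∧
      ‖s i - (∏ l ∈ Finset.range i, d l) * s 0‖ ≤
        ‖∏ l ∈ Finset.range i, d l‖ * ‖s 0‖ * (1/8) := by
  intro i
  induction i using Nat.strong_induction_on with
  | _ i ih =>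
  intro hi
  have hle : ∀ l < i, ‖u l‖ ≤ 2 * ‖s l‖ := fun l hl => (ih l hl (by omega)).1
  have P1 := qic_prod τ d s i (fun l hl => hs l (by omega))
  have P2 := qic_prod τ d u i (fun l hl => hu l (by omega) (hle l hl))
  have S1 : ∑ l ∈ Finset.range i, ‖s l‖ ≤ 1 := by
    refine le_trans ?_ hsum
    apply Finset.sum_le_sum_of_subset_of_nonneg
    · intro a; simp; omega
    · intros; positivity
  have S2 : ∑ l ∈ Finset.range i, ‖u l‖ ≤ 2 := by
    calc _ ≤ ∑ l ∈ Finset.range i, 2 * ‖s l‖ :=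
          Finset.sum_le_sum (fun l hl => hle l (Finset.mem_range.1 hl))
      _ ≤ 2 := by rw [← Finset.mul_sum]; linarith
  have E1 := qic_exp1 (t := τ * ∑ l ∈ Finset.range i, ‖s l‖) (by nlinarith)
  have E2 := qic_exp2 (t := τ * ∑ l ∈ Finset.range i, ‖u l‖) (by nlinarith)
  set D := ∏ l ∈ Finset.range i, d l
  have Q1 : ‖s i - D * s 0‖ ≤ ‖D‖ * ‖s 0‖ * (1/8) := P1.trans (by gcongr)
  have Q2 : ‖u i - D * u 0‖ ≤ ‖D‖ * ‖u 0‖ * (2/7) := P2.trans (by gcongr)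
  refine ⟨?_, Q2, Q1⟩
  have h1 : ‖u i‖ ≤ ‖u i - D * u 0‖ + ‖D * u 0‖ := norm_le_norm_sub_add _ _
  have h2 : ‖D * s 0‖ ≤ ‖s i - D * s 0‖ + ‖s i‖ := by
    rw [norm_sub_rev]; exact norm_le_norm_sub_add _ _
  rw [norm_mul] at h1 h2
  have h3 : ‖D‖ * ‖u 0‖ ≤ ‖D‖ * ‖s 0‖ := by gcongr
  have : 0 ≤ ‖D‖ * ‖s 0‖ := by positivity
  linarith

lemma qic_step (Δ : ℝ) (G : ℂ → ℂ)
    (hG : DifferentiableOn ℂ G {z : ℂ | |z.im| < Δ})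
    (hRe : ∀ z : ℂ, |z.im| < Δ → 0 < (deriv G z).re)
    (τ : ℝ)
    (hτ : ∀ z : ℂ, |z.im| < Δ → ‖iteratedDeriv 2 G z / deriv G z‖ ≤ τ)
    (x : ℝ) (u : ℂ) (hu : |u.im| < Δ) :
    ‖G (x + u) - G x - deriv G x * u‖ ≤
      ‖deriv G x‖ * ‖u‖ * (Real.exp (τ * ‖u‖) - 1) := by
  have hopen : IsOpen {z : ℂ | |z.im| < Δ} :=
    isOpen_lt (continuous_abs.comp Complex.continuous_im) continuous_const
  have hseg : ∀ t ∈ Set.Icc (0:ℝ) 1, |((x:ℂ) + t * u).im| < Δ := by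
    intro t ht
    have : ((x:ℂ) + t * u).im = t * u.im := by simp
    rw [this, abs_mul, abs_of_nonneg ht.1]
    nlinarith [ht.2, abs_nonneg u.im]
  have hpath : ∀ t : ℝ, HasDerivAt (fun t : ℝ => (x:ℂ) + t * u) u t := by
    intro t
    have := ((Complex.ofRealCLM.hasDerivAt (x := t)).mul_const u).const_add (x:ℂ)
    simpa using this
  have hd1 : ∀ z : ℂ, |z.im| < Δ → HasDerivAt G (deriv G z) z := fun z hz =>
    (hG.differentiableAt (hopen.mem_nhds hz)).hasDerivAt
  have hd2 : ∀ z : ℂ, |z.im| < Δ → HasDerivAt (deriv G) (iteratedDeriv 2 G z) z := by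
    intro z hz
    have : iteratedDeriv 2 G = deriv (deriv G) := by
      rw [iteratedDeriv_succ, iteratedDeriv_one]
    rw [this]
    exact ((hG.deriv hopen).differentiableAt (hopen.mem_nhds hz)).hasDerivAt
  have hbd : ∀ z : ℂ, |z.im| < Δ → ‖iteratedDeriv 2 G z‖ ≤ τ * ‖deriv G z‖ := by
    intro z hz
    have h := hτ z hz
    have h0 : 0 < ‖deriv G z‖ := by
      rw [norm_pos_iff]; intro h0; have := hRe z hz; simp [h0] at this
    rwa [norm_div, div_le_iff₀ h0] at h
  have hx : |(x:ℂ).im| < Δ := by simpa using (abs_nonneg _).trans_lt hu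
  have hτ0 : 0 ≤ τ := (norm_nonneg _).trans (hτ x hx)
  -- Gronwall
  have hf : ∀ t ∈ Set.Icc (0:ℝ) 1,
      HasDerivAt (fun t : ℝ => deriv G (x + t * u) - deriv G x)
        (iteratedDeriv 2 G (x + t * u) * u) t := by
    intro t ht
    exact ((hd2 _ (hseg t ht)).comp t (hpath t)).sub_const _
  have gr : ∀ t ∈ Set.Icc (0:ℝ) 1, ‖deriv G (x + t * u) - deriv G x‖ ≤
      ‖deriv G x‖ * (Real.exp (τ * ‖u‖) - 1) := by
    intro t ht
    have key := norm_le_gronwallBound_of_norm_deriv_right_le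
      (f := fun t : ℝ => deriv G (x + t * u) - deriv G x)
      (f' := fun t : ℝ => iteratedDeriv 2 G (x + t * u) * u) (δ := 0) (K := τ * ‖u‖)
      (ε := τ * ‖u‖ * ‖deriv G x‖) (a := 0) (b := 1)
      (fun t ht => (hf t ht).continuousAt.continuousWithinAt)
      (fun t ht => (hf t (Set.Ico_subset_Icc_self ht)).hasDerivWithinAt)
      (by simp)
      (by
        intro t ht
        rw [norm_mul]
        have h1 := hbd _ (hseg t (Set.Ico_subset_Icc_self ht))
        have h2 : ‖deriv G (x + t * u)‖ ≤ ‖deriv G (x + t * u) - deriv G x‖ + ‖deriv G x‖ :=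
          norm_le_norm_sub_add _ _
        calc _ ≤ τ * ‖deriv G (x + t * u)‖ * ‖u‖ := by gcongr
          _ ≤ τ * (‖deriv G (x + t * u) - deriv G x‖ + ‖deriv G x‖) * ‖u‖ := by gcongr
          _ = _ := by ring) t ht
    refine key.trans ?_
    by_cases hK : τ * ‖u‖ = 0
    · rw [hK]; simp [gronwallBound_K0]
    · rw [gronwallBound_of_K_ne_0 hK]
      have hK' : 0 ≤ τ * ‖u‖ := by positivity
      rw [mul_div_cancel_left₀ _ hK, sub_zero]
      simp only [zero_mul, zero_add]
      exact mul_le_mul_of_nonneg_left (sub_le_sub_right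
        (Real.exp_le_exp.2 (mul_le_of_le_one_right hK' ht.2)) 1) (norm_nonneg _)
  have mv := norm_image_sub_le_of_norm_deriv_le_segment_01'
    (f := fun t : ℝ => G (x + t * u) - t * (deriv G x * u))
    (f' := fun t : ℝ => deriv G (x + t * u) * u - deriv G x * u)
    (C := ‖deriv G x‖ * ‖u‖ * (Real.exp (τ * ‖u‖) - 1))
    (by
      intro t ht
      have h1 := (hd1 _ (hseg t ht)).comp t (hpath t)
      have h2 := (Complex.ofRealCLM.hasDerivAt (x := t)).mul_const (deriv G x * u)
      have h3 := h1.sub h2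
      apply HasDerivAt.hasDerivWithinAt
      simp only [Complex.ofRealCLM_apply, Complex.ofReal_one, one_mul] at h3
      exact h3)
    (by
      intro t ht
      rw [← sub_mul, norm_mul]
      calc _ ≤ ‖deriv G x‖ * (Real.exp (τ * ‖u‖) - 1) * ‖u‖ := by
            gcongr; exact gr t (Set.Ico_subset_Icc_self ht)
        _ = _ := by ring)
  simp only [Complex.ofReal_one, one_mul, Complex.ofReal_zero, zero_mul, add_zero, sub_zero] at mv
  have e : G (x + u) - G x - deriv G x * u = G (x + u) - deriv G x * u - G x := by ring
  rw [e]; exact mv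

section dyn
variable {g : ℝ → ℝ}

lemma qic_iter_mono (hgmono : StrictMono g) (k : ℕ) : StrictMono g^[k] := hgmono.iterate k

lemma qic_iter_int (hgper : ∀ x : ℝ, g (x + 1) = g x + 1) (hgmono : StrictMono g)
    (k : ℕ) (x : ℝ) (p : ℤ) : g^[k] (x + p) = g^[k] x + p := by
  let f : CircleDeg1Lift := ⟨⟨g, hgmono.monotone⟩, hgper⟩
  have hf : ∀ y, (f ^ k) y = g^[k] y := by
    intro y; rw [CircleDeg1Lift.coe_pow]; rfl
  rw [← hf, ← hf, CircleDeg1Lift.map_add_int]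

lemma qic_sign (hgper : ∀ x : ℝ, g (x + 1) = g x + 1) (hgmono : StrictMono g)
    {α : ℝ} (hrot : ∀ x : ℝ, Tendsto (fun m : ℕ => (g^[m] x - x) / m) atTop (𝓝 α))
    (k : ℕ) (p : ℤ) (x : ℝ) :
    ((p:ℝ) < k * α → x + p < g^[k] x) ∧ (k * α < (p:ℝ) → g^[k] x < x + p) := by
  let f : CircleDeg1Lift := ⟨⟨g, hgmono.monotone⟩, hgper⟩
  have hf : ∀ (k : ℕ) y, (f ^ k) y = g^[k] y := by
    intro k y; rw [CircleDeg1Lift.coe_pow]; rfl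
  have hα : f.translationNumber = α := by
    refine tendsto_nhds_unique (f.tendsto_translationNumber 0) ?_
    simpa only [hf] using hrot 0
  have h2 : (f ^ k).translationNumber = k * α := by rw [f.translationNumber_pow, hα]
  refine ⟨fun h => ?_, fun h => ?_⟩
  · rw [← hf]; exact CircleDeg1Lift.lt_map_of_int_lt_translationNumber _ (by rwa [h2]) x
  · rw [← hf]; exact CircleDeg1Lift.map_lt_of_translationNumber_lt_int _ (by rwa [h2]) x

lemma qic_order (hgper : ∀ x : ℝ, g (x + 1) = g x + 1) (hgmono : StrictMono g)
    {α : ℝ} (hα : Irrational α)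
    (hrot : ∀ x : ℝ, Tendsto (fun m : ℕ => (g^[m] x - x) / m) atTop (𝓝 α))
    (k m : ℕ) (p p' : ℤ) (x : ℝ) (h : k * α + p ≤ m * α + p') :
    g^[k] x + p ≤ g^[m] x + p' := by
  rcases h.eq_or_lt with h | h
  · have hkm : k = m := by
      by_contra hne
      have h0 : ((k:ℝ) - m) ≠ 0 := by
        rw [sub_ne_zero]; exact_mod_cast hne
      apply hα
      refine ⟨((p' - p : ℤ) : ℚ) / ((k - m : ℤ) : ℚ), ?_⟩
      push_cast
      rw [div_eq_iff h0]; linarith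
    subst hkm
    have : (p:ℝ) = p' := by linarith
    rw [this]
  · rcases le_total k m with hk | hk
    · obtain ⟨d, rfl⟩ := Nat.exists_eq_add_of_le hk
      have := (qic_sign hgper hgmono hrot d (p - p') (g^[k] x)).1
        (by push_cast at h ⊢; linarith)
      rw [← Function.iterate_add_apply, add_comm d k] at this
      push_cast at this; linarith
    · obtain ⟨d, rfl⟩ := Nat.exists_eq_add_of_le hk
      have := (qic_sign hgper hgmono hrot d (p' - p) (g^[m] x)).2
        (by push_cast at h ⊢; linarith)
      rw [← Function.iterate_add_apply, add_comm d m] at this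
      push_cast at this; linarith

/-- no overlap of `(a,b)` with its iterates of order less than `N`. -/
def QicNW (g : ℝ → ℝ) (a b : ℝ) (N : ℕ) : Prop :=
  ∀ k : ℕ, 1 ≤ k → k < N → ∀ p : ℤ, b ≤ g^[k] a + p ∨ g^[k] b + p ≤ a

lemma QicNW.len {a b : ℝ} {N : ℕ} (h : QicNW g a b N) (hN : 2 ≤ N) (hab : a ≤ b)
    (hgmono : StrictMono g) : b ≤ a + 1 := by
  obtain ⟨p, hp1, hp2⟩ : ∃ p : ℤ, a ≤ g a + p ∧ g a + p < a + 1 := by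
    refine ⟨-⌊g a - a⌋, ?_, ?_⟩
    · have := Int.floor_le (g a - a); push_cast; linarith
    · have := Int.lt_floor_add_one (g a - a); push_cast; linarith
  rcases h 1 le_rfl (by omega) p with h | h
  · simp at h; linarith
  · simp at h
    rcases hab.eq_or_lt with h' | h'
    · linarith
    · have := hgmono h'; linarith

lemma qic_disj_sum (N : ℕ) (a b : ℕ → ℝ) (hab : ∀ l < N, a l ≤ b l)
    (h : ∀ l < N, ∀ l' < N, ∀ p : ℤ, (l ≠ l' ∨ p ≠ 0) →
      Disjoint (Set.Ioo (a l) (b l)) (Set.Ioo (a l' + p) (b l' + p))) :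
    ∑ l ∈ Finset.range N, (b l - a l) ≤ 1 := by
  by_contra hcon
  push Not at hcon
  set s : Set ℝ := ⋃ l ∈ Finset.range N, Set.Ioo (a l) (b l) with hs
  have hms : MeasurableSet s := Finset.measurableSet_biUnion _ (fun _ _ => measurableSet_Ioo)
  have hvol : MeasureTheory.volume s = ENNReal.ofReal (∑ l ∈ Finset.range N, (b l - a l)) := by
    rw [hs, MeasureTheory.measure_biUnion_finset, ENNReal.ofReal_sum_of_nonneg]
    · simp
    · intro l hl; have := hab l (Finset.mem_range.1 hl); linarith
    · intro l hl l' hl' hne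
      have := h l (by simpa using hl) l' (by simpa using hl') 0 (Or.inl hne)
      simpa using this
    · intros; exact measurableSet_Ioo
  obtain ⟨x, y, hxy, hd⟩ := MeasureTheory.exists_pair_mem_lattice_not_disjoint_vadd
    (isAddFundamentalDomain_Ioc (T := 1) one_pos 0) hms.nullMeasurableSet (by
      rw [hvol]
      simp only [Real.volume_Ioc, zero_add, sub_zero]
      exact (ENNReal.ofReal_lt_ofReal_iff (by linarith)).2 hcon)
  apply hd
  obtain ⟨x, hx⟩ := x
  obtain ⟨y, hy⟩ := y
  obtain ⟨p, rfl⟩ := AddSubgroup.mem_zmultiples_iff.1 hx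
  obtain ⟨q, rfl⟩ := AddSubgroup.mem_zmultiples_iff.1 hy
  have hpq : q - p ≠ 0 := by
    intro h0
    apply hxy
    have : q = p := by omega
    subst this; rfl
  rw [Set.disjoint_left]
  intro z hz hz'
  rw [Set.mem_vadd_set] at hz hz'
  obtain ⟨u, hu, rfl⟩ := hz
  obtain ⟨v, hv, huv⟩ := hz'
  simp only [hs, Set.mem_iUnion, Finset.mem_range] at hu hv
  obtain ⟨l, hl, hu⟩ := hu
  obtain ⟨l', hl', hv⟩ := hv
  have huv' : (q:ℝ) + v = p + u := by
    simpa [AddSubgroup.vadd_def] using huv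
  refine Set.disjoint_left.1 (h l hl l' hl' (q - p) (Or.inr hpq)) hu ?_
  have : u = v + ((q - p : ℤ) : ℝ) := by push_cast; linarith
  rw [this]
  exact ⟨by linarith [hv.1], by linarith [hv.2]⟩

lemma QicNW.sum (hgper : ∀ x : ℝ, g (x + 1) = g x + 1) (hgmono : StrictMono g)
    {a b : ℝ} {N : ℕ} (h : QicNW g a b N) (hN : 2 ≤ N) (hab : a ≤ b) :
    ∑ l ∈ Finset.range N, (g^[l] b - g^[l] a) ≤ 1 := by
  have hlen := h.len hN hab hgmono
  have key : ∀ l l', l < l' → l' < N → ∀ p : ℤ,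
      g^[l] b ≤ g^[l'] a + p ∨ g^[l'] b + p ≤ g^[l] a := by
    intro l l' hl hl' p
    obtain ⟨k, rfl⟩ := Nat.exists_eq_add_of_lt hl
    have e : ∀ y, g^[l + k + 1] y + p = g^[l] (g^[k+1] y + p) := by
      intro y
      rw [qic_iter_int hgper hgmono, ← Function.iterate_add_apply]; rfl
    rw [e, e]
    rcases h (k+1) (by omega) (by omega) p with h | h
    · left; exact (hgmono.iterate l).monotone h
    · right; exact (hgmono.iterate l).monotone h
  apply qic_disj_sum
  · intro l _; exact (hgmono.iterate l).monotone hab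
  · intro l hl l' hl' p hp
    rw [Set.disjoint_left]
    rintro z ⟨h1, h2⟩ ⟨h3, h4⟩
    rcases lt_trichotomy l l' with hlt | heq | hgt
    · rcases key l l' hlt hl' p with h | h <;> linarith
    · subst heq
      have hp : p ≠ 0 := by tauto
      have h5 : g^[l] b ≤ g^[l] a + 1 := by
        have := (hgmono.iterate l).monotone hlen
        have h6 := qic_iter_int hgper hgmono l a 1
        push_cast at h6
        linarith
      rcases lt_or_gt_of_ne hp with h | h
      · have : (p:ℝ) ≤ -1 := by exact_mod_cast (by omega : p ≤ -1)
        linarith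
      · have : (1:ℝ) ≤ p := by exact_mod_cast (by omega : 1 ≤ p)
        linarith
    · rcases key l' l hgt hl (-p) with h | h <;> push_cast at h <;> linarith

lemma qic_wander_of_sum (hgper : ∀ x : ℝ, g (x + 1) = g x + 1) (hgmono : StrictMono g)
    {α : ℝ} (hα : Irrational α)
    (hrot : ∀ x : ℝ, Tendsto (fun m : ℕ => (g^[m] x - x) / m) atTop (𝓝 α))
    (a b C : ℝ) (hab : a ≤ b)
    (hC : ∀ N, ∑ l ∈ Finset.range N, (g^[l] b - g^[l] a) ≤ C) (N : ℕ) : QicNW g a b N := by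
  intro k hk _ p
  by_contra hcon
  push Not at hcon
  obtain ⟨h1, h2⟩ := hcon
  have hs0 : ∀ l, 0 ≤ g^[l] b - g^[l] a := fun l => by
    have := (hgmono.iterate l).monotone hab; linarith
  have hsum : ∀ M, ∑ i ∈ Finset.range M, (g^[k*i] b - g^[k*i] a) ≤ C := by
    intro M
    have hinj : Set.InjOn (fun i => k * i) (Finset.range M : Set ℕ) := by
      intro i _ j _ hij
      exact Nat.eq_of_mul_eq_mul_left (by omega) hij
    rw [← Finset.sum_image (f := fun l => g^[l] b - g^[l] a) hinj]
    refine le_trans ?_ (hC (k * M))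
    apply Finset.sum_le_sum_of_subset_of_nonneg
    · intro l hl
      simp only [Finset.mem_image, Finset.mem_range] at hl ⊢
      obtain ⟨i, hi, rfl⟩ := hl
      exact Nat.mul_lt_mul_of_pos_left hi (by omega)
    · intro l _ _; exact hs0 l
  have e : ∀ y (i : ℕ), g^[k * (i+1)] y + ((i + 1 : ℕ):ℝ) * p = g^[k*i] (g^[k] y + p) + i * p := by
    intro y i
    rw [qic_iter_int hgper hgmono, ← Function.iterate_add_apply, Nat.mul_succ]
    push_cast; ring
  have hne : (k:ℝ) * α + p ≠ 0 := by
    intro h0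
    apply hα
    refine ⟨((-p : ℤ) : ℚ) / ((k : ℤ) : ℚ), ?_⟩
    have : (k:ℝ) ≠ 0 := by exact_mod_cast (by omega : k ≠ 0)
    push_cast
    rw [div_eq_iff this]; linarith
  obtain ⟨c, hc⟩ := exists_nat_gt C
  rcases lt_or_gt_of_ne hne with hlt | hgt
  · -- negative
    have tele : ∀ M : ℕ, b - (g^[k*M] b + M * p) ≤
        ∑ i ∈ Finset.range M, (g^[k*i] b - g^[k*i] a) := by
      intro M
      induction M with
      | zero => simp
      | succ M ih =>
        rw [Finset.sum_range_succ, e]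
        have := (hgmono.iterate (k*M)) h2
        linarith
    obtain ⟨M, hM⟩ := exists_nat_gt ((c:ℝ) / (-((k:ℝ) * α + p)))
    rw [div_lt_iff₀ (by linarith)] at hM
    have := (qic_sign hgper hgmono hrot (k*M) (-(c:ℤ) - M * p) b).2
      (by push_cast; linarith)
    push_cast at this
    have t := tele M
    have := hsum M
    linarith
  · have tele : ∀ M : ℕ, (g^[k*M] a + M * p) - a ≤
        ∑ i ∈ Finset.range M, (g^[k*i] b - g^[k*i] a) := by
      intro M
      induction M with
      | zero => simp
      | succ M ih =>
        rw [Finset.sum_range_succ, e]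
        have := (hgmono.iterate (k*M)) h1
        linarith
    obtain ⟨M, hM⟩ := exists_nat_gt ((c:ℝ) / (((k:ℝ) * α + p)))
    rw [div_lt_iff₀ (by linarith)] at hM
    have := (qic_sign hgper hgmono hrot (k*M) ((c:ℤ) - M * p) a).1
      (by push_cast; linarith)
    push_cast at this
    have t := tele M
    have := hsum M
    linarith

lemma qic_limit (hgper : ∀ x : ℝ, g (x + 1) = g x + 1) (hgmono : StrictMono g)
    (hgsurj : Function.Surjective g) (δ : ℝ)
    (h : ∀ N : ℕ, ∃ a b, a + δ ≤ b ∧ QicNW g a b N) : ∃ a, ∀ N, QicNW g a (a + δ) N := by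
  have hcont : Continuous g := hgmono.monotone.continuous_of_surjective hgsurj
  let t : ℕ → Set ℝ := fun N => Set.Icc 0 1 ∩ {a | QicNW g a (a + δ) N}
  have hclosed : ∀ N, IsClosed (t N) := by
    intro N
    refine isClosed_Icc.inter ?_
    have : {a | QicNW g a (a + δ) N} = ⋂ k : ℕ, ⋂ (_ : 1 ≤ k), ⋂ (_ : k < N), ⋂ p : ℤ,
        ({a | a + δ ≤ g^[k] a + p} ∪ {a | g^[k] (a + δ) + p ≤ a}) := by
      ext a; simp [QicNW]
    rw [this]
    refine isClosed_iInter fun k => isClosed_iInter fun _ => isClosed_iInter fun _ =>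
      isClosed_iInter fun p => ?_
    have hk := hcont.iterate k
    exact (isClosed_le (by fun_prop) (by fun_prop)).union
      (isClosed_le (by fun_prop) (by fun_prop))
  obtain ⟨a, ha⟩ := IsCompact.nonempty_iInter_of_sequence_nonempty_isCompact_isClosed t
    (by
      rintro N a ⟨h1, h2⟩
      exact ⟨h1, fun k hk hk' => h2 k hk (by omega)⟩)
    (by
      intro N
      obtain ⟨a, b, hab, hw⟩ := h N
      refine ⟨Int.fract a, ⟨Int.fract_nonneg a, (Int.fract_lt_one a).le⟩, ?_⟩
      intro k hk hk' p
      have e1 : Int.fract a = a + ((-⌊a⌋ : ℤ) : ℝ) := by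
        rw [← Int.self_sub_floor]; push_cast; ring
      have e2 : Int.fract a + δ = (a + δ) + ((-⌊a⌋ : ℤ) : ℝ) := by rw [e1]; ring
      rw [e2, qic_iter_int hgper hgmono, e1, qic_iter_int hgper hgmono]
      have h3 := (hgmono.iterate k).monotone hab
      rcases hw k hk hk' p with h | h
      · left; linarith
      · right; linarith)
    (isCompact_Icc.inter_right (by
      have : {a | QicNW g a (a + δ) 0} = Set.univ := by ext a; simp [QicNW]
      rw [this]; exact isClosed_univ)) hclosed
  exact ⟨a, fun N => (Set.mem_iInter.1 ha N).2⟩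

end dyn

lemma qic_cf_irr {α : ℝ} (hα : Irrational α) (n : ℕ) : Irrational (cfGauss α n) := by
  induction n with
  | zero => exact hα
  | succ n ih =>
    simp only [cfGauss]
    rw [irrational_inv_iff, ← Int.self_sub_floor]
    exact ih.sub_intCast _

lemma qic_cf_fract {α : ℝ} (hα : Irrational α) (n : ℕ) :
    0 < Int.fract (cfGauss α n) ∧ Int.fract (cfGauss α n) < 1 := by
  refine ⟨lt_of_le_of_ne (Int.fract_nonneg _) ?_, Int.fract_lt_one _⟩
  intro h
  have := qic_cf_irr hα n
  apply this
  refine ⟨⌊cfGauss α n⌋, ?_⟩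
  have := Int.self_sub_floor (cfGauss α n)
  push_cast; linarith

lemma qic_cfA_pos {α : ℝ} (hα : Irrational α) (n : ℕ) : 1 ≤ cfA α (n + 1) := by
  have h := qic_cf_fract hα n
  rw [cfA, Int.le_floor]
  simp only [cfGauss]
  push_cast
  exact (one_lt_inv₀ h.1).2 h.2 |>.le

lemma qic_cfA_cast {α : ℝ} (hα : Irrational α) (n : ℕ) :
    (((cfA α (n + 1)).toNat : ℕ) : ℤ) = cfA α (n + 1) :=
  Int.toNat_of_nonneg (by have := qic_cfA_pos hα n; omega)

lemma qic_cfQ_one {α : ℝ} (hα : Irrational α) (n : ℕ) : 1 ≤ cfQ α n ∧ 1 ≤ cfQ α (n+1) := by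
  induction n with
  | zero =>
    refine ⟨le_rfl, ?_⟩
    have := qic_cfA_cast hα 0
    have := qic_cfA_pos hα 0
    simp only [cfQ]; simp only [zero_add] at *; omega
  | succ n ih =>
    refine ⟨ih.2, ?_⟩
    simp only [cfQ]
    have := ih.1
    exact le_add_left this

lemma qic_cfQ_ge {α : ℝ} (hα : Irrational α) (n : ℕ) : n + 1 ≤ cfQ α (n+1) := by
  induction n with
  | zero => exact (qic_cfQ_one hα 0).2
  | succ n ih =>
    simp only [cfQ]
    have h1 := (qic_cfQ_one hα n).1
    have h2 : 1 ≤ (cfA α (n+2)).toNat := by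
      have := qic_cfA_cast hα (n+1)
      have := qic_cfA_pos hα (n+1)
      change 1 ≤ (cfA α (n+1+1)).toNat
      omega
    have : 1 * cfQ α (n+1) ≤ (cfA α (n+2)).toNat * cfQ α (n+1) := Nat.mul_le_mul_right _ h2
    omega

lemma qic_theta {α : ℝ} (hα : Irrational α) (n : ℕ) :
    (cfQ α (n+1) * α - cfP α (n+1)) =
      - Int.fract (cfGauss α (n+1)) * (cfQ α n * α - cfP α n) ∧
      (cfQ α n * α - cfP α n) ≠ 0 := by
  have hA : ∀ n, (((cfA α (n + 1)).toNat : ℕ) : ℝ) = cfA α (n+1) := fun n => by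
    exact_mod_cast qic_cfA_cast hα n
  have hfr : ∀ n, Int.fract (cfGauss α n) = cfGauss α n - cfA α n := fun n =>
    (Int.self_sub_floor _).symm
  have hmul : ∀ n, cfGauss α (n+1) * Int.fract (cfGauss α n) = 1 := fun n => by
    simp only [cfGauss]
    exact inv_mul_cancel₀ (qic_cf_fract hα n).1.ne'
  induction n with
  | zero =>
    have h0 : (cfQ α 0 * α - cfP α 0 : ℝ) = Int.fract (cfGauss α 0) := by
      rw [hfr]; simp [cfQ, cfP, cfGauss]
    refine ⟨?_, ?_⟩
    · rw [h0, hfr (0+1)]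
      have h1 := hmul 0
      have h2 := hA 0
      rw [hfr 0] at h1 ⊢
      simp only [zero_add, cfQ, cfP] at *
      rw [h2]
      push_cast
      have h3 : cfGauss α 0 = α := rfl
      linear_combination h1 - cfA α 1 * h3
    · rw [h0]; exact (qic_cf_fract hα 0).1.ne'
  | succ n ih =>
    obtain ⟨ih1, ih2⟩ := ih
    refine ⟨?_, ?_⟩
    · have h1 := hmul (n+1)
      have h2 := hA (n+1)
      have e : ((cfQ α (n+1+1) : ℕ) * α - cfP α (n+1+1) : ℝ) =
          cfA α (n+2) * (cfQ α (n+1) * α - cfP α (n+1)) + (cfQ α n * α - cfP α n) := by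
        simp only [cfQ, cfP]
        push_cast
        rw [h2]; ring
      rw [e, hfr (n+1+1)]
      linear_combination cfGauss α (n+1+1) * ih1 - (cfQ α n * α - cfP α n) * h1
    · rw [ih1]
      exact mul_ne_zero (neg_ne_zero.2 (qic_cf_fract hα (n+1)).1.ne') ih2

lemma qic_det {α : ℝ} (hα : Irrational α) (n : ℕ) :
    (cfP α (n+1) * cfQ α n - cfP α n * cfQ α (n+1) = 1) ∨
    (cfP α (n+1) * cfQ α n - cfP α n * cfQ α (n+1) = -1) := by
  induction n with
  | zero =>
    left
    have := qic_cfA_cast hα 0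
    simp only [cfP, cfQ, zero_add] at *
    rw [this]; push_cast; ring
  | succ n ih =>
    have h2 := qic_cfA_cast hα (n+1)
    have e : (cfP α (n+1+1) * cfQ α (n+1) - cfP α (n+1) * cfQ α (n+1+1)) =
      -(cfP α (n+1) * cfQ α n - cfP α n * cfQ α (n+1)) := by
      simp only [cfP, cfQ]
      push_cast
      simp only [Nat.add_assoc, Nat.reduceAdd] at h2 ⊢
      rw [h2]; ring
    rw [e]
    rcases ih with h | h <;> rw [h] <;> simp

lemma qic_best {α : ℝ} (hα : Irrational α) (n : ℕ) (k : ℕ) (hk : 1 ≤ k) (hk' : k < cfQ α (n+1))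
    (p : ℤ) : |(cfQ α n * α - cfP α n : ℝ)| ≤ |(k * α + p : ℝ)| := by
  obtain ⟨c, d, h1, h2⟩ : ∃ c d : ℤ, (k:ℤ) = c * cfQ α n + d * cfQ α (n+1) ∧
      p = -(c * cfP α n + d * cfP α (n+1)) := by
    rcases qic_det hα n with h | h
    · refine ⟨k * cfP α (n+1) + p * cfQ α (n+1), -(k * cfP α n + p * cfQ α n), ?_, ?_⟩
      · linear_combination -(k:ℤ) * h
      · linear_combination -p * h
    · refine ⟨-(k * cfP α (n+1) + p * cfQ α (n+1)), (k * cfP α n + p * cfQ α n), ?_, ?_⟩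
      · linear_combination (k:ℤ) * h
      · linear_combination p * h
  obtain ⟨t1, t2⟩ := qic_theta hα n
  set θ := (cfQ α n * α - cfP α n : ℝ)
  have hr := qic_cf_fract hα (n+1)
  set r := Int.fract (cfGauss α (n+1))
  have e : (k * α + p : ℝ) = (c - d * r) * θ := by
    have h1' : (k:ℝ) = c * cfQ α n + d * cfQ α (n+1) := by exact_mod_cast h1
    have h2' : (p:ℝ) = -(c * cfP α n + d * cfP α (n+1)) := by exact_mod_cast h2
    rw [h1', h2']
    linear_combination (d:ℝ) * t1
  rw [e, abs_mul]
  have hq := (qic_cfQ_one hα n)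
  suffices h : 1 ≤ |(c - d * r : ℝ)| by nlinarith [abs_nonneg θ]
  have hqn : (1:ℤ) ≤ cfQ α n := by exact_mod_cast hq.1
  have hkz : (1:ℤ) ≤ k := by exact_mod_cast hk
  have hkz' : (k:ℤ) < cfQ α (n+1) := by exact_mod_cast hk'
  rcases lt_trichotomy d 0 with hd | hd | hd
  · have hc : 1 ≤ c := by nlinarith
    have hcR : (1:ℝ) ≤ c := by exact_mod_cast hc
    have hdR : (d:ℝ) < 0 := by exact_mod_cast hd
    refine le_trans ?_ (le_abs_self _)
    nlinarith
  · subst hd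
    have hc : c ≠ 0 := by rintro rfl; simp at h1; omega
    simp only [Int.cast_zero, zero_mul, sub_zero]
    exact_mod_cast Int.one_le_abs hc
  · have hc : c ≤ -1 := by nlinarith
    have hcR : (c:ℝ) ≤ -1 := by exact_mod_cast hc
    have hdR : (0:ℝ) < d := by exact_mod_cast hd
    refine le_trans ?_ (neg_le_abs _)
    nlinarith

lemma qic_cf_nw {g : ℝ → ℝ} (hgper : ∀ x : ℝ, g (x + 1) = g x + 1) (hgmono : StrictMono g)
    {α : ℝ} (hα : Irrational α)
    (hrot : ∀ x : ℝ, Tendsto (fun m : ℕ => (g^[m] x - x) / m) atTop (𝓝 α)) (n : ℕ) (x : ℝ) :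
    QicNW g (min x (cfIter g α n x)) (max x (cfIter g α n x)) (cfQ α (n+1)) := by
  intro k hk hk' p
  have hb := qic_best hα n k hk hk' p
  have ord := fun k m p p' => qic_order hgper hgmono hα hrot k m p p' x
  have hF : g^[k] (cfIter g α n x) + p = g^[k + cfQ α n] x + ((p - cfP α n : ℤ):ℝ) := by
    have := qic_iter_int hgper hgmono k (g^[cfQ α n] x) (-cfP α n)
    rw [cfIter, sub_eq_add_neg, Function.iterate_add_apply]
    push_cast at this ⊢
    rw [this]; ring
  have hF0 : cfIter g α n x = g^[cfQ α n] x + ((-cfP α n : ℤ):ℝ) := by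
    rw [cfIter]; push_cast; ring
  rcases le_total 0 (cfQ α n * α - cfP α n : ℝ) with hθ | hθ
  · have hx : x ≤ cfIter g α n x := by
      have := ord 0 (cfQ α n) 0 (-cfP α n) (by push_cast; linarith)
      rw [hF0]; simpa using this
    rw [min_eq_left hx, max_eq_right hx, hF]
    rw [abs_of_nonneg hθ, le_abs] at hb
    rcases hb with hb | hb
    · left
      rw [hF0]
      exact ord _ _ _ _ (by push_cast; linarith)
    · right
      have := ord (k + cfQ α n) 0 (p - cfP α n) 0 (by push_cast; linarith)
      simpa using this
  · have hx : cfIter g α n x ≤ x := by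
      have := ord (cfQ α n) 0 (-cfP α n) 0 (by push_cast; linarith)
      rw [hF0]; simpa using this
    rw [min_eq_right hx, max_eq_left hx, hF]
    rw [abs_of_nonpos hθ, le_abs] at hb
    rcases hb with hb | hb
    · left
      have := ord 0 (k + cfQ α n) 0 (p - cfP α n) (by push_cast; linarith)
      simpa using this
    · right
      rw [hF0]
      exact ord _ _ _ _ (by push_cast; linarith)

lemma qic_real_step {Δ : ℝ} (hΔ : 0 < Δ) {g : ℝ → ℝ} {G : ℂ → ℂ} {τ : ℝ}
    (hGreal : ∀ x : ℝ, G (x : ℂ) = ((g x : ℝ) : ℂ))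
    (hstep : ∀ (x : ℝ) (u : ℂ), |u.im| < Δ → ‖G (x + u) - G x - deriv G x * u‖ ≤
      ‖deriv G x‖ * ‖u‖ * (Real.exp (τ * ‖u‖) - 1)) (x y : ℝ) :
    ‖((g y - g x : ℝ) : ℂ) - deriv G x * ((y - x : ℝ) : ℂ)‖ ≤
      ‖deriv G x‖ * ‖((y - x : ℝ) : ℂ)‖ * (Real.exp (τ * ‖((y - x : ℝ) : ℂ)‖) - 1) := by
  have h := hstep x ((y - x : ℝ) : ℂ) (by rw [Complex.ofReal_im]; simpa using hΔ)
  have e : (x:ℂ) + ((y - x : ℝ) : ℂ) = (y:ℂ) := by push_cast; ring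
  rw [e, hGreal, hGreal, ← Complex.ofReal_sub] at h
  exact h

lemma qic_double {g : ℝ → ℝ} {G : ℂ → ℂ} {τ : ℝ}
    (hgper : ∀ x : ℝ, g (x + 1) = g x + 1) (hgmono : StrictMono g)
    {α : ℝ} (hα : Irrational α)
    (hrot : ∀ x : ℝ, Tendsto (fun m : ℕ => (g^[m] x - x) / m) atTop (𝓝 α))
    (hτ0 : 0 ≤ τ) (hτ : τ ≤ 1/9)
    (hreal : ∀ x y : ℝ, ‖((g y - g x : ℝ) : ℂ) - deriv G x * ((y - x : ℝ) : ℂ)‖ ≤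
      ‖deriv G x‖ * ‖((y - x : ℝ) : ℂ)‖ * (Real.exp (τ * ‖((y - x : ℝ) : ℂ)‖) - 1))
    (a L : ℝ) (hL : 0 ≤ L) (h : ∀ N, QicNW g a (a + L) N) :
    ∀ N, QicNW g a (a + 2 * L) N := by
  apply qic_wander_of_sum hgper hgmono hα hrot a (a + 2 * L) 3 (by linarith)
  intro N
  let s : ℕ → ℂ := fun l => ((g^[l] a - g^[l] (a + L) : ℝ) : ℂ)
  let u : ℕ → ℂ := fun l => ((g^[l] (a + 2 * L) - g^[l] (a + L) : ℝ) : ℂ)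
  let d : ℕ → ℂ := fun l => deriv G ((g^[l] (a + L) : ℝ) : ℂ)
  have hs : ∀ l, ‖s l‖ = g^[l] (a + L) - g^[l] a := by
    intro l
    have := (hgmono.iterate l).monotone (by linarith : a ≤ a + L)
    simp only [s]
    rw [Complex.norm_real, Real.norm_eq_abs, abs_of_nonpos (by linarith)]; ring
  have hu : ∀ l, ‖u l‖ = g^[l] (a + 2 * L) - g^[l] (a + L) := by
    intro l
    have := (hgmono.iterate l).monotone (by linarith : a + L ≤ a + 2 * L)
    simp only [u]
    rw [Complex.norm_real, Real.norm_eq_abs, abs_of_nonneg (by linarith)]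
  have hst : ∀ b l, ‖((g^[l+1] b - g^[l+1] (a + L) : ℝ) : ℂ) -
      d l * ((g^[l] b - g^[l] (a + L) : ℝ) : ℂ)‖ ≤
      ‖d l‖ * ‖((g^[l] b - g^[l] (a + L) : ℝ) : ℂ)‖ *
        (Real.exp (τ * ‖((g^[l] b - g^[l] (a + L) : ℝ) : ℂ)‖) - 1) := by
    intro b l
    rw [Function.iterate_succ_apply', Function.iterate_succ_apply']
    exact hreal _ _
  have hsum : ∑ l ∈ Finset.range N, ‖s l‖ ≤ 1 := by
    have h2 := (h (N+2)).sum hgper hgmono (by omega) (by linarith)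
    refine le_trans ?_ h2
    simp only [← hs]
    apply Finset.sum_le_sum_of_subset_of_nonneg
    · intro a; simp only [Finset.mem_range]; omega
    · intro l _ _; positivity
  have hc := qic_compare τ hτ0 hτ d s u N (fun l _ => hst a l) (fun l _ _ => hst (a + 2 * L) l)
    hsum (by rw [hs, hu]; simp only [Function.iterate_zero, id]; linarith)
  calc _ ≤ ∑ l ∈ Finset.range N, 3 * ‖s l‖ := by
        apply Finset.sum_le_sum
        intro l hl
        have := (hc l (Finset.mem_range.1 hl).le).1
        rw [hu] at this
        have := hs l
        linarith
    _ ≤ 3 := by rw [← Finset.mul_sum]; linarith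

lemma qic_small {Δ : ℝ} (hΔ : 0 < Δ) {g : ℝ → ℝ} {G : ℂ → ℂ} {τ : ℝ}
    (hgper : ∀ x : ℝ, g (x + 1) = g x + 1) (hgmono : StrictMono g)
    (hgsurj : Function.Surjective g)
    {α : ℝ} (hα : Irrational α)
    (hrot : ∀ x : ℝ, Tendsto (fun m : ℕ => (g^[m] x - x) / m) atTop (𝓝 α))
    (hτ0 : 0 ≤ τ) (hτ : τ ≤ 1/9)
    (hreal : ∀ x y : ℝ, ‖((g y - g x : ℝ) : ℂ) - deriv G x * ((y - x : ℝ) : ℂ)‖ ≤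
      ‖deriv G x‖ * ‖((y - x : ℝ) : ℂ)‖ * (Real.exp (τ * ‖((y - x : ℝ) : ℂ)‖) - 1)) :
    ∃ n₀ : ℕ, 1 ≤ n₀ ∧ ∀ n ≥ n₀, ∀ x, 2 * |cfIter g α n x - x| < Δ := by
  by_contra hcon
  push Not at hcon
  obtain ⟨a, ha⟩ := qic_limit hgper hgmono hgsurj (Δ/2) (by
    intro N
    obtain ⟨n, hn, x, hx⟩ := hcon (N+1) (by omega)
    refine ⟨_, _, ?_, fun k hk hk' => qic_cf_nw hgper hgmono hα hrot n x k hk ?_⟩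
    · have := max_sub_min_eq_abs x (cfIter g α n x)
      linarith
    · have := qic_cfQ_ge hα n; omega)
  have hk : ∀ k : ℕ, ∀ N, QicNW g a (a + 2^k * (Δ/2)) N := by
    intro k
    induction k with
    | zero => simpa using ha
    | succ k ih =>
      have := qic_double hgper hgmono hα hrot hτ0 hτ hreal a _ (by positivity) ih
      rwa [pow_succ', mul_assoc]
  obtain ⟨k, hk'⟩ := pow_unbounded_of_one_lt (1 / (Δ/2)) (one_lt_two)
  rw [div_lt_iff₀ (by linarith)] at hk'
  have h0 : 0 ≤ 2^k * (Δ/2) := by positivity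
  have := (hk k 2).len le_rfl (by linarith) hgmono
  linarith

/-- **Quasi-invariance of the curves `Γₙ` in Hausdorff hyperbolic distance.**
Let `g ∈ D^ω(𝕋,Δ)` with holomorphic extension `G` to the strip `B_Δ`, `Re G′ > 0` on `B_Δ`,
irrational rotation number `α`, nonlinearity `τ = sup_{B_Δ} |(log g′)′| < 1/9`, and fix
`1/2 < y₀ < 1`.  There are `C₀ > 0` and `n₀ ≥ 1` such that for all `n ≥ n₀`, setting
`Γₙ = {x + i |mₙ(x)| y₀ : x ∈ ℝ}`, for every `0 ≤ j ≤ q_{n+1}` the image `G^j(Γₙ)` is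
contained in `ℍ` and is at Hausdorff hyperbolic distance at most `2C₀` from `Γₙ`. -/
theorem quasi_invariant_curves
    (Δ : ℝ) (hΔ : 0 < Δ)
    (g : ℝ → ℝ) (G : ℂ → ℂ) (V : Set ℂ)
    (hVopen : IsOpen V) (hVΔ : closure {z : ℂ | |z.im| < Δ} ⊆ V)
    (hVshift : ∀ z : ℂ, z ∈ V ↔ z + 1 ∈ V)
    (hGholo : DifferentiableOn ℂ G V) (hGinj : Set.InjOn G V)
    (hGonto : closure {z : ℂ | |z.im| < Δ} ⊆ G '' V)
    (hGreal : ∀ x : ℝ, G (x : ℂ) = ((g x : ℝ) : ℂ))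
    (hgmono : StrictMono g) (hgsurj : Function.Surjective g)
    (hgper : ∀ x : ℝ, g (x + 1) = g x + 1)
    (hGper : ∀ z ∈ V, G (z + 1) = G z + 1)
    (hRe : ∀ z : ℂ, |z.im| < Δ → 0 < (deriv G z).re)
    (α : ℝ) (hα : Irrational α)
    (hrot : ∀ x : ℝ, Tendsto (fun m : ℕ => (g^[m] x - x) / m) atTop (𝓝 α))
    (τ : ℝ) (hτsmall : τ < 1 / 9)
    (hτ : ∀ z : ℂ, |z.im| < Δ → ‖iteratedDeriv 2 G z / deriv G z‖ ≤ τ)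
    (y₀ : ℝ) (hy₀ : 1 / 2 < y₀) (hy₀1 : y₀ < 1) :
    ∃ C₀ > (0 : ℝ), ∃ n₀ : ℕ, 1 ≤ n₀ ∧ ∀ n ≥ n₀, ∀ j ≤ cfQ α (n + 1),
      (∀ x : ℝ, 0 < (G^[j] (liftPt g α n y₀ x)).im) ∧
      (∀ x : ℝ, ∃ x' : ℝ,
        ∃ (h : 0 < (G^[j] (liftPt g α n y₀ x)).im) (h' : 0 < (liftPt g α n y₀ x').im),
          dist (⟨G^[j] (liftPt g α n y₀ x), h⟩ : UpperHalfPlane)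
            (⟨liftPt g α n y₀ x', h'⟩ : UpperHalfPlane) ≤ 2 * C₀) ∧
      (∀ x' : ℝ, ∃ x : ℝ,
        ∃ (h : 0 < (G^[j] (liftPt g α n y₀ x)).im) (h' : 0 < (liftPt g α n y₀ x').im),
          dist (⟨G^[j] (liftPt g α n y₀ x), h⟩ : UpperHalfPlane)
            (⟨liftPt g α n y₀ x', h'⟩ : UpperHalfPlane) ≤ 2 * C₀) := by
  have hopen : IsOpen {z : ℂ | |z.im| < Δ} :=
    isOpen_lt (continuous_abs.comp Complex.continuous_im) continuous_const
  have hG : DifferentiableOn ℂ G {z : ℂ | |z.im| < Δ} :=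
    hGholo.mono (subset_closure.trans hVΔ)
  have hτ0 : 0 ≤ τ := (norm_nonneg _).trans (hτ 0 (by simpa using hΔ))
  have hstep := qic_step Δ G hG hRe τ hτ
  have hiter : ∀ (l : ℕ) (x : ℝ), G^[l] (x : ℂ) = ((g^[l] x : ℝ) : ℂ) := by
    intro l
    induction l with
    | zero => intro x; rfl
    | succ l ih => intro x; rw [Function.iterate_succ_apply, hGreal, ih]; rfl
  have hreal := qic_real_step hΔ hGreal hstep
  obtain ⟨n₀, hn₀1, hn₀⟩ := qic_small hΔ hgper hgmono hgsurj hα hrot hτ0 hτsmall.le hreal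
  have hd : ∀ x : ℝ, ∃ r : ℝ, 0 < r ∧ deriv G x = r := by
    intro x
    have hx : |(x:ℂ).im| < Δ := by simpa using hΔ
    have h1 : HasDerivAt G (deriv G x) (x:ℂ) :=
      (hG.differentiableAt (hopen.mem_nhds hx)).hasDerivAt
    refine ⟨(deriv G x).re, hRe _ hx, ?_⟩
    have h2 := h1.comp_ofReal
    have h3 := Complex.imCLM.hasFDerivAt.comp_hasDerivAt x h2
    have h4 : (⇑Complex.imCLM ∘ fun y : ℝ => G (y:ℂ)) = fun _ => (0:ℝ) := by
      funext y; simp [hGreal]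
    rw [h4] at h3
    have h5 := h3.unique (hasDerivAt_const x (0:ℝ))
    apply Complex.ext
    · simp
    · simpa using h5
  refine ⟨Real.arsinh 3, Real.arsinh_pos_iff.2 (by norm_num), n₀, hn₀1, ?_⟩
  intro n hn j hj
  -- commutation
  have hcomm : ∀ (l : ℕ) (x : ℝ), g^[l] (cfIter g α n x) = cfIter g α n (g^[l] x) := by
    intro l x
    have := qic_iter_int hgper hgmono l (g^[cfQ α n] x) (-cfP α n)
    rw [cfIter, cfIter, ← Function.iterate_add_apply, add_comm (cfQ α n) l,
      Function.iterate_add_apply]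
    push_cast at this
    rw [sub_eq_add_neg, this]; ring
  have hmne : ∀ x, 0 < |cfIter g α n x - x| := by
    intro x
    rw [abs_pos]
    intro h0
    have hne := (qic_theta hα n).2
    have hs := qic_sign hgper hgmono hrot (cfQ α n) (cfP α n) x
    rw [cfIter] at h0
    rcases lt_or_gt_of_ne hne with h | h
    · have := hs.2 (by linarith); linarith
    · have := hs.1 (by linarith); linarith
  -- the key estimate
  have key : ∀ x : ℝ, ∃ (h : 0 < (G^[j] (liftPt g α n y₀ x)).im)
      (h' : 0 < (liftPt g α n y₀ (g^[j] x)).im),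
      dist (⟨G^[j] (liftPt g α n y₀ x), h⟩ : UpperHalfPlane)
            (⟨liftPt g α n y₀ (g^[j] x), h'⟩ : UpperHalfPlane) ≤ 2 * Real.arsinh 3 := by
    intro x
    set m := |cfIter g α n x - x| with hm
    set m' := |cfIter g α n (g^[j] x) - g^[j] x| with hm'
    have hmpos : 0 < m := hmne x
    have hNW := qic_cf_nw hgper hgmono hα hrot n x
    have hQ2 : 2 ≤ cfQ α (n+1) := by have := qic_cfQ_ge hα n; omega
    have hsum := hNW.sum hgper hgmono hQ2 min_le_max
    let s : ℕ → ℂ := fun l => ((g^[l] (cfIter g α n x) - g^[l] x : ℝ) : ℂ)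
    let u : ℕ → ℂ := fun l => G^[l] (liftPt g α n y₀ x) - ((g^[l] x : ℝ) : ℂ)
    let d : ℕ → ℂ := fun l => deriv G ((g^[l] x : ℝ) : ℂ)
    have hsn : ∀ l, ‖s l‖ = |cfIter g α n (g^[l] x) - g^[l] x| := by
      intro l
      simp only [s]
      rw [Complex.norm_real, Real.norm_eq_abs, hcomm]
    have hsn' : ∀ l, ‖s l‖ = g^[l] (max x (cfIter g α n x)) - g^[l] (min x (cfIter g α n x)) := by
      intro l
      simp only [s]
      rw [Complex.norm_real, Real.norm_eq_abs, (hgmono.iterate l).monotone.map_max,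
        (hgmono.iterate l).monotone.map_min, max_sub_min_eq_abs]
    have hu0 : u 0 = Complex.I * ((m * y₀ : ℝ) : ℂ) := by
      simp only [u, liftPt, Function.iterate_zero, id]
      push_cast; rw [← hm]; ring
    have hu0n : ‖u 0‖ = m * y₀ := by
      rw [hu0, norm_mul, Complex.norm_I, one_mul, Complex.norm_real, Real.norm_eq_abs,
        abs_of_pos (by positivity)]
    have hs0n : ‖s 0‖ = m := by rw [hsn]; rfl
    obtain ⟨-, hU, hS⟩ := qic_compare τ hτ0 hτsmall.le d s u j
      (by
        intro l _
        have := hreal (g^[l] x) (g^[l] (cfIter g α n x))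
        simp only [s, d]
        rw [Function.iterate_succ_apply', Function.iterate_succ_apply']
        exact this)
      (by
        intro l hl hle
        have him : |(u l).im| < Δ := by
          refine (Complex.abs_im_le_norm _).trans_lt (hle.trans_lt ?_)
          rw [hsn]; exact hn₀ n hn _
        have := hstep (g^[l] x) (u l) him
        have e : ((g^[l] x : ℝ) : ℂ) + u l = G^[l] (liftPt g α n y₀ x) := by
          simp only [u]; ring
        rw [e] at this
        have e2 : u (l+1) = G (G^[l] (liftPt g α n y₀ x)) - G ((g^[l] x : ℝ) : ℂ) := by
          simp only [u]
          rw [Function.iterate_succ_apply', Function.iterate_succ_apply', hGreal]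
        rw [e2]
        exact this)
      (by
        refine le_trans ?_ hsum
        simp only [hsn']
        apply Finset.sum_le_sum_of_subset_of_nonneg
        · intro a; simp only [Finset.mem_range]; omega
        · intro l _ _; rw [← hsn']; positivity)
      (by rw [hu0n, hs0n]; nlinarith) j le_rfl
    obtain ⟨D, hDpos, hD⟩ : ∃ D : ℝ, 0 < D ∧ ∏ l ∈ Finset.range j, d l = D := by
      choose r hr hr' using hd
      refine ⟨∏ l ∈ Finset.range j, r (g^[l] x), Finset.prod_pos (fun l _ => hr _), ?_⟩
      push_cast
      exact Finset.prod_congr rfl (fun l _ => hr' _)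
    rw [hD, Complex.norm_real, Real.norm_eq_abs, abs_of_pos hDpos] at hU hS
    rw [hu0n] at hU
    rw [hs0n] at hS
    have hsj : ‖s j‖ = m' := hsn j
    have hDs : ‖(D:ℂ) * s 0‖ = D * m := by
      rw [norm_mul, hs0n, Complex.norm_real, Real.norm_eq_abs, abs_of_pos hDpos]
    have b1 : m' ≤ D * m * (9/8) := by
      have : ‖s j‖ ≤ ‖s j - D * s 0‖ + ‖(D:ℂ) * s 0‖ := norm_le_norm_sub_add _ _
      rw [hsj, hDs] at this; linarith
    have b2 : D * m * (7/8) ≤ m' := by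
      have : ‖(D:ℂ) * s 0‖ ≤ ‖(D:ℂ) * s 0 - s j‖ + ‖s j‖ := norm_le_norm_sub_add _ _
      rw [norm_sub_rev, hsj, hDs] at this; linarith
    have hDu : ‖(D:ℂ) * u 0‖ = D * (m * y₀) := by
      rw [norm_mul, hu0n, Complex.norm_real, Real.norm_eq_abs, abs_of_pos hDpos]
    have b3 : ‖u j‖ ≤ D * (m * y₀) * (9/7) := by
      have : ‖u j‖ ≤ ‖u j - D * u 0‖ + ‖(D:ℂ) * u 0‖ := norm_le_norm_sub_add _ _
      rw [hDu] at this; linarith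
    have hDui : ((D:ℂ) * u 0).im = D * (m * y₀) := by
      rw [hu0]; simp
    have b4 : D * (m * y₀) * (5/7) ≤ (G^[j] (liftPt g α n y₀ x)).im := by
      have h1 : (u j).im = (G^[j] (liftPt g α n y₀ x)).im := by simp [u]
      have h2 := (Complex.abs_im_le_norm (u j - D * u 0)).trans hU
      rw [Complex.sub_im, hDui, h1] at h2
      have := (abs_le.1 h2).1
      linarith
    set Y := D * (m * y₀) with hY
    have hYpos : 0 < Y := by positivity
    have hlim : (liftPt g α n y₀ (g^[j] x)).im = m' * y₀ := by
      simp only [liftPt]; simp [← hm']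
    have b5 : Y * (7/8) ≤ m' * y₀ := by
      have := mul_le_mul_of_nonneg_right b2 (by linarith : (0:ℝ) ≤ y₀)
      rw [hY]; linarith
    have b6 : m' * y₀ ≤ Y * (9/8) := by
      have := mul_le_mul_of_nonneg_right b1 (by linarith : (0:ℝ) ≤ y₀)
      rw [hY]; linarith
    have hpos : 0 < (G^[j] (liftPt g α n y₀ x)).im := by linarith
    have hpos' : 0 < (liftPt g α n y₀ (g^[j] x)).im := by rw [hlim]; linarith
    refine ⟨hpos, hpos', ?_⟩
    rw [UpperHalfPlane.dist_eq]
    refine mul_le_mul_of_nonneg_left (Real.arsinh_le_arsinh.2 ?_) (by norm_num)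
    change dist (G^[j] (liftPt g α n y₀ x)) (liftPt g α n y₀ (g^[j] x)) /
      (2 * √((G^[j] (liftPt g α n y₀ x)).im * (liftPt g α n y₀ (g^[j] x)).im)) ≤ 3
    have hdist : dist (G^[j] (liftPt g α n y₀ x)) (liftPt g α n y₀ (g^[j] x)) ≤ 3 * Y := by
      rw [dist_eq_norm]
      have e : G^[j] (liftPt g α n y₀ x) - liftPt g α n y₀ (g^[j] x) =
          u j - Complex.I * ((m' * y₀ : ℝ) : ℂ) := by
        simp only [u, liftPt]
        push_cast; rw [← hm']; ring
      rw [e]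
      refine (norm_sub_le _ _).trans ?_
      rw [norm_mul, Complex.norm_I, one_mul, Complex.norm_real, Real.norm_eq_abs,
        abs_of_pos (by linarith)]
      linarith
    have hsq : Y / 2 ≤ √((G^[j] (liftPt g α n y₀ x)).im * (liftPt g α n y₀ (g^[j] x)).im) := by
      apply Real.le_sqrt_of_sq_le
      rw [hlim]
      calc (Y/2)^2 ≤ (Y * (5/7)) * (Y * (7/8)) := by nlinarith [sq_nonneg Y]
        _ ≤ _ := by gcongr
    rw [div_le_iff₀ (by linarith)]
    linarith
  refine ⟨fun x => (key x).1, fun x => ⟨g^[j] x, key x⟩, fun x' => ?_⟩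
  obtain ⟨x, rfl⟩ := hgsurj.iterate j x'
  exact ⟨x, key x⟩
end
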